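/- arXiv:1808.05459 — 9 statements merged into one kernel-verified Lean document; each statement's English description precedes it below -/
import Mathlib

section
/- For every mesh pattern (π,R) with π a permutation of {1,…,k}, there exists an L2-formula ψ with k free variables x₁,…,x_k such that for every n, every permutation σ of {1,…,n} and every tuple (a₁,…,a_k) of elements of {1,…,n}: ψ is satisfied in M_σ under the assignment x_i := a_i if and only if the map i ↦ a_i is an occurrence of the mesh pattern (π,R) in σ. -/
open FirstOrder

/-- Relation symbols of the language `L2` (TOTO): two binary relation symbols `<P` and `<V`. -/
inductive TwoOrderRel : ℕ → Type
  | ltP : TwoOrderRel 2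
  | ltV : TwoOrderRel 2

/-- The first-order language `L2` with exactly two binary relation symbols `<P` and `<V`. -/
def L2 : FirstOrder.Language := ⟨fun _ => Empty, TwoOrderRel⟩

/-- The `L2`-structure `M_σ` associated to a permutation `σ` of `{1,…,n}`:
the domain is `Fin n`, `i <P j` is interpreted as `i < j`, and `i <V j` as `σ i < σ j`. -/
def permStruc2 {n : ℕ} (σ : Equiv.Perm (Fin n)) : L2.Structure (Fin n) where
  funMap := fun {_} f _ => Empty.elim f
  RelMap
    | .ltP => fun x => x 0 < x 1
    | .ltV => fun x => σ (x 0) < σ (x 1)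

/-- Satisfaction of an `L2`-sentence in the structure `M_σ`. -/
def Sat2 {n : ℕ} (σ : Equiv.Perm (Fin n)) (φ : L2.Sentence) : Prop :=
  letI := permStruc2 σ
  (Fin n) ⊨ φ

/-- Realization in `M_σ` of an `L2`-formula with free variables indexed by `α`,
under the assignment `v`. -/
def Real2 {n : ℕ} {α : Type} (σ : Equiv.Perm (Fin n)) (φ : L2.Formula α)
    (v : α → Fin n) : Prop :=
  letI := permStruc2 σ
  φ.Realize v

/-- `a` is an occurrence of the pattern `π` (of size `k`) in `σ` (of size `n`):
`a` is strictly increasing and the values `σ ∘ a` are ordered as prescribed by `π`. -/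
def IsOccurrence {k n : ℕ} (π : Equiv.Perm (Fin k)) (σ : Equiv.Perm (Fin n))
    (a : Fin k → Fin n) : Prop :=
  StrictMono a ∧ ∀ j h : Fin k, σ (a j) < σ (a h) ↔ π j < π h

/-- The extended sequence of positions `p_0 = 0 < p_1 < … < p_k < p_{k+1} = n+1`
determined by `a : Fin k → Fin n`, positions of `σ` being `1`-indexed
(`p_i = a(i) + 1` for `1 ≤ i ≤ k`). -/
def extPos {k n : ℕ} (a : Fin k → Fin n) (i : Fin (k + 2)) : ℕ :=
  if _ : (i : ℕ) = 0 then 0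
  else if _ : (i : ℕ) = k + 1 then n + 1
  else (a ⟨(i : ℕ) - 1, by have := i.isLt; omega⟩ : ℕ) + 1

/-- The extended sequence of values `v_0 = 0 < v_1 < … < v_k < v_{k+1} = n+1`, where
`v_1 < … < v_k` are the (`1`-indexed) values `σ(a(1)),…,σ(a(k))` listed in increasing
order; when `a` is an occurrence of `π` in `σ`, the `j`-th smallest of these values is
`σ(a(π⁻¹(j)))`. -/
def extVal {k n : ℕ} (π : Equiv.Perm (Fin k)) (σ : Equiv.Perm (Fin n))
    (a : Fin k → Fin n) (j : Fin (k + 2)) : ℕ :=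
  if _ : (j : ℕ) = 0 then 0
  else if _ : (j : ℕ) = k + 1 then n + 1
  else (σ (a (π⁻¹ ⟨(j : ℕ) - 1, by have := j.isLt; omega⟩)) : ℕ) + 1

/-- `a` is an occurrence of the mesh pattern `(π, R)` in `σ`: it is an occurrence of `π`
such that, for every `(i,j) ∈ R`, there is no point `t` of `σ` with
`p_i < t < p_{i+1}` and `v_j < σ(t) < v_{j+1}` (everything `1`-indexed). -/
def IsMeshOccurrence {k n : ℕ} (π : Equiv.Perm (Fin k))
    (R : Set (Fin (k + 1) × Fin (k + 1))) (σ : Equiv.Perm (Fin n))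
    (a : Fin k → Fin n) : Prop :=
  IsOccurrence π σ a ∧
    ∀ i j : Fin (k + 1), (i, j) ∈ R →
      ¬ ∃ t : Fin n,
          extPos a i.castSucc < (t : ℕ) + 1 ∧ (t : ℕ) + 1 < extPos a i.succ ∧
          extVal π σ a j.castSucc < (σ t : ℕ) + 1 ∧ (σ t : ℕ) + 1 < extVal π σ a j.succ

/-- Uniform definability over all `M_σ`. -/
def UDef {α : Type} (P : ∀ n : ℕ, Equiv.Perm (Fin n) → (α → Fin n) → Prop) : Prop :=
  ∃ ψ : L2.Formula α, ∀ (n : ℕ) (σ : Equiv.Perm (Fin n)) (a : α → Fin n),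
    Real2 σ ψ a ↔ P n σ a

namespace UDef

variable {α : Type} {P Q : ∀ n : ℕ, Equiv.Perm (Fin n) → (α → Fin n) → Prop}

theorem ltP (x y : α) : UDef (fun n (_ : Equiv.Perm (Fin n)) a => a x < a y) := by
  refine ⟨Language.Relations.formula₂ (L := L2) TwoOrderRel.ltP (Language.Term.var x)
    (Language.Term.var y), fun n σ a => ?_⟩
  letI := permStruc2 σ
  exact Language.Formula.realize_rel₂

theorem ltV (x y : α) : UDef (fun n (σ : Equiv.Perm (Fin n)) a => σ (a x) < σ (a y)) := by
  refine ⟨Language.Relations.formula₂ (L := L2) TwoOrderRel.ltV (Language.Term.var x)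
    (Language.Term.var y), fun n σ a => ?_⟩
  letI := permStruc2 σ
  exact Language.Formula.realize_rel₂

theorem not (h : UDef P) : UDef (fun n σ a => ¬ P n σ a) := by
  obtain ⟨φ, h⟩ := h
  exact ⟨φ.not, fun n σ a => not_congr (h n σ a)⟩

theorem and (h : UDef P) (h' : UDef Q) : UDef (fun n σ a => P n σ a ∧ Q n σ a) := by
  obtain ⟨φ, h⟩ := h
  obtain ⟨φ', h'⟩ := h'
  refine ⟨φ ⊓ φ', fun n σ a => ?_⟩
  simp only [← h, ← h']
  letI := permStruc2 σ
  exact Language.Formula.realize_inf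

theorem const (p : Prop) : UDef (α := α) (fun _ _ _ => p) := by
  by_cases hp : p
  · refine ⟨⊤, fun n σ a => ?_⟩
    letI := permStruc2 σ
    simp only [hp, iff_true]
    exact Language.Formula.realize_top.2 trivial
  · refine ⟨⊥, fun n σ a => ?_⟩
    letI := permStruc2 σ
    simp only [hp, iff_false]
    exact fun h => Language.Formula.realize_bot.1 h

theorem congr (h : UDef P) (e : ∀ n σ a, P n σ a ↔ Q n σ a) : UDef Q := by
  obtain ⟨φ, h⟩ := h
  exact ⟨φ, fun n σ a => (h n σ a).trans (e n σ a)⟩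

theorem imp (h : UDef P) (h' : UDef Q) : UDef (fun n σ a => P n σ a → Q n σ a) :=
  (h.and h'.not).not.congr fun n σ a => by tauto

theorem iff (h : UDef P) (h' : UDef Q) : UDef (fun n σ a => P n σ a ↔ Q n σ a) :=
  ((h.imp h').and (h'.imp h)).congr fun n σ a => by tauto

theorem all {β : Type} [Finite β]
    {F : β → ∀ n : ℕ, Equiv.Perm (Fin n) → (α → Fin n) → Prop}
    (h : ∀ b, UDef (F b)) : UDef (fun n σ a => ∀ b, F b n σ a) := by
  choose φ h using h
  refine ⟨Language.Formula.iInf φ, fun n σ a => ?_⟩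
  simp only [← h]
  letI := permStruc2 σ
  exact Language.Formula.realize_iInf

theorem ex {F : ∀ n : ℕ, Equiv.Perm (Fin n) → (α ⊕ Unit → Fin n) → Prop}
    (h : UDef F) : UDef (fun n σ a => ∃ t : Fin n, F n σ (Sum.elim a (fun _ => t))) := by
  obtain ⟨φ, h⟩ := h
  refine ⟨φ.iExs Unit, fun n σ a => ?_⟩
  simp only [← h]
  letI := permStruc2 σ
  refine (Language.Formula.realize_iExs (φ := φ) (v := a)).trans ?_
  exact ⟨fun ⟨i, hi⟩ => ⟨i (), hi⟩, fun ⟨t, ht⟩ => ⟨fun _ => t, ht⟩⟩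

end UDef

theorem udef_pos_lt {k : ℕ} (i : Fin (k + 2)) :
    UDef (α := Fin k ⊕ Unit) (fun n _ a =>
      extPos (fun x => a (Sum.inl x)) i < (a (Sum.inr ()) : ℕ) + 1) := by
  by_cases h0 : (i : ℕ) = 0
  · exact (UDef.const True).congr fun n σ a => by simp [extPos, h0]
  by_cases h1 : (i : ℕ) = k + 1
  · exact (UDef.const False).congr fun n σ a => by
      have := (a (Sum.inr ())).isLt
      simp only [extPos, h0, h1, dif_neg, dif_pos, not_false_eq_true]
      constructor
      · exact False.elim
      · simp
  · exact (UDef.ltP (Sum.inl ⟨(i : ℕ) - 1, by have := i.isLt; omega⟩) (Sum.inr ())).congr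
      fun n σ a => by simp [extPos, h0, h1]

theorem udef_lt_pos {k : ℕ} (i : Fin (k + 2)) :
    UDef (α := Fin k ⊕ Unit) (fun n _ a =>
      (a (Sum.inr ()) : ℕ) + 1 < extPos (fun x => a (Sum.inl x)) i) := by
  by_cases h0 : (i : ℕ) = 0
  · exact (UDef.const False).congr fun n σ a => by simp [extPos, h0]
  by_cases h1 : (i : ℕ) = k + 1
  · exact (UDef.const True).congr fun n σ a => by simp [extPos, h1]
  · exact (UDef.ltP (Sum.inr ()) (Sum.inl ⟨(i : ℕ) - 1, by have := i.isLt; omega⟩)).congr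
      fun n σ a => by simp [extPos, h0, h1]

theorem udef_val_lt {k : ℕ} (π : Equiv.Perm (Fin k)) (i : Fin (k + 2)) :
    UDef (α := Fin k ⊕ Unit) (fun n σ a =>
      extVal π σ (fun x => a (Sum.inl x)) i < (σ (a (Sum.inr ())) : ℕ) + 1) := by
  by_cases h0 : (i : ℕ) = 0
  · exact (UDef.const True).congr fun n σ a => by simp [extVal, h0]
  by_cases h1 : (i : ℕ) = k + 1
  · exact (UDef.const False).congr fun n σ a => by
      have := (σ (a (Sum.inr ()))).isLt
      simp only [extVal, h0, h1, dif_neg, dif_pos, not_false_eq_true]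
      constructor
      · exact False.elim
      · simp
  · exact (UDef.ltV (Sum.inl (π⁻¹ ⟨(i : ℕ) - 1, by have := i.isLt; omega⟩)) (Sum.inr ())).congr
      fun n σ a => by simp [extVal, h0, h1]

theorem udef_lt_val {k : ℕ} (π : Equiv.Perm (Fin k)) (i : Fin (k + 2)) :
    UDef (α := Fin k ⊕ Unit) (fun n σ a =>
      (σ (a (Sum.inr ())) : ℕ) + 1 < extVal π σ (fun x => a (Sum.inl x)) i) := by
  by_cases h0 : (i : ℕ) = 0
  · exact (UDef.const False).congr fun n σ a => by simp [extVal, h0]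
  by_cases h1 : (i : ℕ) = k + 1
  · exact (UDef.const True).congr fun n σ a => by simp [extVal, h1]
  · exact (UDef.ltV (Sum.inr ()) (Sum.inl (π⁻¹ ⟨(i : ℕ) - 1, by have := i.isLt; omega⟩))).congr
      fun n σ a => by simp [extVal, h0, h1]

theorem mesh_pattern_occurrence_formula (k : ℕ) (π : Equiv.Perm (Fin k))
    (R : Set (Fin (k + 1) × Fin (k + 1))) :
    ∃ ψ : L2.Formula (Fin k), ∀ (n : ℕ) (σ : Equiv.Perm (Fin n)) (a : Fin k → Fin n),
      Real2 σ ψ a ↔ IsMeshOccurrence π R σ a := by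
  have H1 : UDef (fun n (σ : Equiv.Perm (Fin n)) (a : Fin k → Fin n) => IsOccurrence π σ a) := by
    refine UDef.and (P := fun n _ a => StrictMono a) ?_ ?_
    · exact (UDef.all fun i : Fin k => UDef.all fun j : Fin k =>
        (UDef.const (i < j)).imp (UDef.ltP i j)).congr
        fun n σ a => ⟨fun h i j => h i j, fun h i j => @h i j⟩
    · exact UDef.all fun j : Fin k => UDef.all fun h : Fin k =>
        (UDef.ltV j h).iff (UDef.const (π j < π h))
  exact H1.and (UDef.all fun i : Fin (k + 1) => UDef.all fun j : Fin (k + 1) =>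
    (UDef.const ((i, j) ∈ R)).imp
      (UDef.ex ((udef_pos_lt i.castSucc).and ((udef_lt_pos i.succ).and
        ((udef_val_lt π j.castSucc).and (udef_lt_val π j.succ))))).not)
end

section
/- If a size-preserving map T from permutations to permutations is TOTO-definable, then for every TOTO-definable set E of permutations the preimage T⁻¹(E) is TOTO-definable; in particular, since the set of identity permutations is TOTO-definable, the set of T-sortable permutations (those σ with T(σ) equal to the identity) is TOTO-definable, and so is the set of permutations sorted by any fixed iterate T^k. -/
open FirstOrder

/-- The type of all permutations of all finite sizes. -/
def Perms := Σ n : ℕ, Equiv.Perm (Fin n)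

/-- A set of permutations is TOTO-definable if some `L2`-sentence defines it. -/
def TOTODef (E : Set Perms) : Prop :=
  ∃ φ : L2.Sentence, ∀ (n : ℕ) (σ : Equiv.Perm (Fin n)), Sat2 σ φ ↔ (⟨n, σ⟩ : Perms) ∈ E

/-- A size-preserving map from permutations to permutations. -/
def PermOp : Type :=
  ∀ n : ℕ, Equiv.Perm (Fin n) → Equiv.Perm (Fin n)

/-- A sorting operator `T` is TOTO-definable if some `L2`-formula `φ(x,y)` defines the
new positional order: `T(σ)⁻¹(σ(i)) < T(σ)⁻¹(σ(j))` iff `φ(i,j)` holds in `M_σ`. -/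
def PermOpTOTODef (T : PermOp) : Prop :=
  ∃ φ : L2.Formula (Fin 2), ∀ (n : ℕ) (σ : Equiv.Perm (Fin n)) (i j : Fin n),
    (T n σ)⁻¹ (σ i) < (T n σ)⁻¹ (σ j) ↔ Real2 σ φ ![i, j]

theorem tr_term_aux {n : ℕ} (σ τ : Equiv.Perm (Fin n)) (e : Fin n → Fin n) {α : Type}
    (t : L2.Term α) (v : α → Fin n) :
    @FirstOrder.Language.Term.realize L2 (Fin n) (permStruc2 τ) α (e ∘ v) t =
      e (@FirstOrder.Language.Term.realize L2 (Fin n) (permStruc2 σ) α v t) := by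
  cases t with
  | var a => rfl
  | func f ts => exact Empty.elim f

theorem tr_aux (T : PermOp) (hT : PermOpTOTODef T) {α : Type} {k : ℕ}
    (ψ : L2.BoundedFormula α k) :
    ∃ ψ' : L2.BoundedFormula α k, ∀ (n : ℕ) (σ : Equiv.Perm (Fin n))
      (v : α → Fin n) (xs : Fin k → Fin n),
      @FirstOrder.Language.BoundedFormula.Realize L2 (Fin n) (permStruc2 σ) α k ψ' v xs ↔
      @FirstOrder.Language.BoundedFormula.Realize L2 (Fin n) (permStruc2 (T n σ)) α k ψ
        ((σ.trans (T n σ)⁻¹) ∘ v) ((σ.trans (T n σ)⁻¹) ∘ xs) := by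
  induction ψ with
  | falsum => exact ⟨.falsum, fun n σ v xs => Iff.rfl⟩
  | equal t₁ t₂ =>
    refine ⟨.equal t₁ t₂, fun n σ v xs => ?_⟩
    simp only [FirstOrder.Language.BoundedFormula.Realize, ← Sum.comp_elim,
      tr_term_aux σ (T n σ)]
    exact (Equiv.apply_eq_iff_eq _).symm
  | @rel k l R ts =>
    cases R with
    | ltP =>
      obtain ⟨φ, hφ⟩ := hT
      refine ⟨FirstOrder.Language.BoundedFormula.relabel (k := 0) id
        (FirstOrder.Language.BoundedFormula.subst φ ts), fun n σ v xs => ?_⟩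
      letI := permStruc2 σ
      have h := hφ n σ ((ts 0).realize (Sum.elim v xs)) ((ts 1).realize (Sum.elim v xs))
      rw [FirstOrder.Language.BoundedFormula.realize_relabel,
        FirstOrder.Language.BoundedFormula.realize_subst]
      simp only [FirstOrder.Language.BoundedFormula.Realize, ← Sum.comp_elim,
        tr_term_aux σ (T n σ)]
      refine Iff.trans ?_ h.symm
      unfold Real2 FirstOrder.Language.Formula.Realize
      apply iff_of_eq
      congr 1
      · funext i
        fin_cases i <;> rfl
      · exact Subsingleton.elim _ _
    | ltV =>
      refine ⟨.rel TwoOrderRel.ltV ts, fun n σ v xs => ?_⟩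
      simp only [FirstOrder.Language.BoundedFormula.Realize, ← Sum.comp_elim,
        tr_term_aux σ (T n σ)]
      have key : ∀ a b : Fin n, σ a < σ b ↔
          T n σ ((T n σ)⁻¹ (σ a)) < T n σ ((T n σ)⁻¹ (σ b)) := by
        intro a b
        simp
      exact key _ _
  | imp _ _ ih₁ ih₂ =>
    obtain ⟨a, ha⟩ := ih₁
    obtain ⟨b, hb⟩ := ih₂
    exact ⟨.imp a b, fun n σ v xs => imp_congr (ha n σ v xs) (hb n σ v xs)⟩
  | all _ ih =>
    obtain ⟨a, ha⟩ := ih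
    refine ⟨.all a, fun n σ v xs => ?_⟩
    simp only [FirstOrder.Language.BoundedFormula.Realize, ha, Fin.comp_snoc]
    constructor
    · intro h b
      have := h ((σ.trans (T n σ)⁻¹).symm b)
      rwa [Equiv.apply_symm_apply] at this
    · intro h a
      exact h _

theorem preimage_aux (T : PermOp) (hT : PermOpTOTODef T) (E : Set Perms) (hE : TOTODef E) :
    TOTODef {p : Perms | (⟨p.1, T p.1 p.2⟩ : Perms) ∈ E} := by
  obtain ⟨ψ, hψ⟩ := hE
  obtain ⟨ψ', h⟩ := tr_aux T hT ψ
  refine ⟨ψ', fun n σ => ?_⟩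
  refine Iff.trans ?_ (hψ n (T n σ))
  unfold Sat2 FirstOrder.Language.Sentence.Realize FirstOrder.Language.Formula.Realize
  refine (h n σ _ _).trans (iff_of_eq ?_)
  congr 1
  · exact Subsingleton.elim _ _
  · exact Subsingleton.elim _ _

theorem one_aux : TOTODef {p : Perms | p.2 = 1} := by
  refine ⟨.all (.all (.imp
    (.rel TwoOrderRel.ltP ![.var (Sum.inr 0), .var (Sum.inr 1)])
    (.rel TwoOrderRel.ltV ![.var (Sum.inr 0), .var (Sum.inr 1)]))), fun n σ => ?_⟩
  have : (∀ a b : Fin n, a < b → σ a < σ b) ↔ σ = 1 := by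
    constructor
    · intro h
      have hm : StrictMono σ := fun a b => h a b
      have := Subsingleton.elim (hm.orderIsoOfSurjective σ σ.surjective) (OrderIso.refl (Fin n))
      ext a
      exact congrArg Fin.val (congrArg (fun f : Fin n ≃o Fin n => f a) this)
    · rintro rfl a b h
      exact h
  exact Iff.trans Iff.rfl this

theorem sortable_TOTO_definable (T : PermOp) (hT : PermOpTOTODef T) :
    (∀ E : Set Perms, TOTODef E →
        TOTODef {p : Perms | (⟨p.1, T p.1 p.2⟩ : Perms) ∈ E}) ∧
      TOTODef {p : Perms | p.2 = 1} ∧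
      TOTODef {p : Perms | T p.1 p.2 = 1} ∧
      ∀ k : ℕ, TOTODef {p : Perms | (T p.1)^[k] p.2 = 1} := by
  refine ⟨preimage_aux T hT, one_aux, preimage_aux T hT _ one_aux, fun k => ?_⟩
  induction k with
  | zero => exact one_aux
  | succ k ih => exact preimage_aux T hT _ ih
end

section
/- For every partition λ (a finite multiset of positive integers), the set C_λ of permutations whose cycle type equals λ is TOTO-definable. -/
open FirstOrder

/-- The cycle type of a permutation, with fixed points counted as cycles of length 1
(a partition of `n`, as a multiset). -/
def fullCycleType {n : ℕ} (σ : Equiv.Perm (Fin n)) : Multiset ℕ :=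
  σ.cycleType + Multiset.replicate (n - σ.support.card) 1

theorem fct_sum {n : ℕ} (σ : Equiv.Perm (Fin n)) : (fullCycleType σ).sum = n := by
  have h : σ.support.card ≤ n := by simpa using Finset.card_le_univ σ.support
  simp only [fullCycleType, Multiset.sum_add, Equiv.Perm.sum_cycleType, Multiset.sum_replicate,
    smul_eq_mul, mul_one]
  omega

theorem fin_mono_id {n : ℕ} (f : Fin n → Fin n) (hf : StrictMono f) : ∀ i, f i = i := by
  intro i
  have hs : Function.Surjective f := Finite.surjective_of_injective hf.injective
  have h : StrictMono.orderIsoOfSurjective f hf hs = OrderIso.refl _ := Subsingleton.elim _ _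
  simpa using congrArg (fun g => g i) h

/-- Atomic formula between two quantified variables. -/
def atomF {N : ℕ} (R : TwoOrderRel 2) (i j : Fin N) : L2.Formula (Empty ⊕ Fin N) :=
  FirstOrder.Language.Relations.formula₂ (L := L2) R
    (FirstOrder.Language.Term.var (Sum.inr i)) (FirstOrder.Language.Term.var (Sum.inr j))

noncomputable def diagF {N : ℕ} (τ : Equiv.Perm (Fin N)) : L2.Formula (Empty ⊕ Fin N) :=
  FirstOrder.Language.Formula.iInf
      (fun p : {p : Fin N × Fin N // p.1 < p.2} => atomF .ltP p.1.1 p.1.2) ⊓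
    FirstOrder.Language.Formula.iInf
      (fun p : {p : Fin N × Fin N // τ p.1 < τ p.2} => atomF .ltV p.1.1 p.1.2)

noncomputable def sentF (lam : Multiset ℕ) : L2.Sentence :=
  (FirstOrder.Language.Sentence.cardGe L2 lam.sum ⊓
    (FirstOrder.Language.Sentence.cardGe L2 (lam.sum + 1)).not) ⊓
  FirstOrder.Language.Formula.iSup
    (fun τ : {τ : Equiv.Perm (Fin lam.sum) // fullCycleType τ = lam} =>
      FirstOrder.Language.Formula.iExs (Fin lam.sum) (diagF τ.1))

theorem diagF_iff {n N : ℕ} (σ : Equiv.Perm (Fin n)) (τ : Equiv.Perm (Fin N))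
    (v : Empty ⊕ Fin N → Fin n) :
    (letI := permStruc2 σ; (diagF τ).Realize v) ↔
      (∀ i j, i < j → v (.inr i) < v (.inr j)) ∧
      (∀ i j, τ i < τ j → σ (v (.inr i)) < σ (v (.inr j))) := by
  letI := permStruc2 σ
  simp only [diagF, FirstOrder.Language.Formula.realize_inf,
    FirstOrder.Language.Formula.realize_iInf, atomF, FirstOrder.Language.Formula.realize_rel₂,
    Subtype.forall, Prod.forall, FirstOrder.Language.Term.realize_var]
  rfl

theorem sentF_iff {n : ℕ} (σ : Equiv.Perm (Fin n)) (lam : Multiset ℕ) :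
    Sat2 σ (sentF lam) ↔ n = lam.sum ∧
      ∃ τ : Equiv.Perm (Fin lam.sum), fullCycleType τ = lam ∧ ∃ v : Fin lam.sum → Fin n,
        (∀ i j, i < j → v i < v j) ∧ (∀ i j, τ i < τ j → σ (v i) < σ (v j)) := by
  letI := permStruc2 σ
  have h1 := FirstOrder.Language.Sentence.realize_cardGe L2 (M := Fin n) lam.sum
  have h2 := FirstOrder.Language.Sentence.realize_cardGe L2 (M := Fin n) (lam.sum + 1)
  rw [Cardinal.mk_fin, Nat.cast_le] at h1 h2
  unfold FirstOrder.Language.Sentence.Realize at h1 h2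
  unfold Sat2 sentF FirstOrder.Language.Sentence.Realize
  rw [FirstOrder.Language.Formula.realize_inf, FirstOrder.Language.Formula.realize_inf,
    FirstOrder.Language.Formula.realize_not, h1, h2, FirstOrder.Language.Formula.realize_iSup]
  simp only [FirstOrder.Language.Formula.realize_iExs, Subtype.exists, diagF_iff, Sum.elim_inr,
    exists_prop]
  refine and_congr_left' ?_
  omega

theorem cLambda_TOTO_definable (lam : Multiset ℕ) (hlam : ∀ i ∈ lam, 0 < i) :
    TOTODef {p : Perms | fullCycleType p.2 = lam} := by
  refine ⟨sentF lam, fun n σ => ?_⟩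
  rw [sentF_iff]
  show _ ↔ fullCycleType σ = lam
  constructor
  · rintro ⟨rfl, τ, hτ, v, hv, hs⟩
    have hid := fin_mono_id v (fun i j h => hv i j h)
    have h2 := fin_mono_id (fun i => σ (τ.symm i)) (fun i j h => by
      have := hs (τ.symm i) (τ.symm j) (by simpa using h)
      simpa [hid] using this)
    have : σ = τ := by
      ext i
      have := h2 (τ i)
      simp at this
      rw [this]
    rw [this, hτ]
  · intro h
    have hn : n = lam.sum := by rw [← h, fct_sum]
    subst hn
    exact ⟨rfl, σ, h, id, fun _ _ h => h, fun _ _ h => h⟩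
end

section
/- For every partition λ (a finite multiset of positive integers), the set D_λ of permutations whose cycle type is obtained from λ by adding some number k ≥ 0 of additional parts equal to 1 (that is, D_λ is the union over k ≥ 0 of C_{λ ∪ (1^k)}) is TOTO-definable. -/
open FirstOrder

namespace TotoAux

open FirstOrder.Language

lemma perm_eq_of_lt {n : ℕ} (σ ρ : Equiv.Perm (Fin n))
    (h : ∀ a b, σ a < σ b ↔ ρ a < ρ b) : σ = ρ := by
  let e : Fin n ≃o Fin n := 
    { toEquiv := ρ.symm.trans σ
      map_rel_iff' := by
        intro a b
        have := h (ρ.symm b) (ρ.symm a)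
        simp only [Equiv.apply_symm_apply] at this
        simpa using not_congr this }
  have he : e = OrderIso.refl _ := Subsingleton.elim _ _
  ext a
  have : e (ρ a) = ρ a := by rw [he]; rfl
  simp [e] at this
  rw [this]

abbrev V (m : ℕ) := (Empty ⊕ Fin m) ⊕ Fin 4

def vx {m : ℕ} (i : Fin m) : L2.Term (V m) := Term.var (Sum.inl (Sum.inr i))
def vy {m : ℕ} (i : Fin 4) : L2.Term (V m) := Term.var (Sum.inr i)

def ltP {m : ℕ} (s t : L2.Term (V m)) : L2.Formula (V m) :=
  Relations.formula₂ (L := L2) (TwoOrderRel.ltP : L2.Relations 2) s t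
def ltV {m : ℕ} (s t : L2.Term (V m)) : L2.Formula (V m) :=
  Relations.formula₂ (L := L2) (TwoOrderRel.ltV : L2.Relations 2) s t

/-- `t = ρ s`. -/
noncomputable def graph {m : ℕ} (τ : Equiv.Perm (Fin m)) (s t : L2.Term (V m)) :
    L2.Formula (V m) :=
  (Formula.iSup fun i : Fin m => (s.equal (vx i)) ⊓ (t.equal (vx (τ i)))) ⊔
  ((Formula.iInf fun i : Fin m => ∼(s.equal (vx i))) ⊓ t.equal s)

noncomputable def inj (m : ℕ) : L2.Formula (V m) :=
  Formula.iInf fun p : Fin m × Fin m =>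
    if p.1 = p.2 then ⊤ else ∼((vx p.1).equal (vx p.2))

noncomputable def body {m : ℕ} (τ : Equiv.Perm (Fin m)) : L2.Formula (V m) :=
  inj m ⊓ ((graph τ (vy 0) (vy 2) ⊓ graph τ (vy 1) (vy 3)).imp
    ((ltV (vy 0) (vy 1)).iff (ltP (vy 2) (vy 3))))

noncomputable def sent {m : ℕ} (τ : Equiv.Perm (Fin m)) : L2.Sentence :=
  Formula.iExs (Fin m) (Formula.iAlls (Fin 4) (body τ))

lemma sat_sent {m n : ℕ} (τ : Equiv.Perm (Fin m)) (σ : Equiv.Perm (Fin n)) :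
    Sat2 σ (sent τ) ↔ ∃ x : Fin m → Fin n, ∀ y : Fin 4 → Fin n,
      (∀ i j, i ≠ j → x i ≠ x j) ∧
      (((∃ i, y 0 = x i ∧ y 2 = x (τ i)) ∨ ((∀ i, y 0 ≠ x i) ∧ y 2 = y 0)) ∧
       ((∃ i, y 1 = x i ∧ y 3 = x (τ i)) ∨ ((∀ i, y 1 ≠ x i) ∧ y 3 = y 1)) →
        (σ (y 0) < σ (y 1) ↔ y 2 < y 3)) := by
  letI := permStruc2 σ
  have hP : ∀ (s t : L2.Term (V m)) (v : V m → Fin n), (ltP s t).Realize v ↔ s.realize v < t.realize v := by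
    intro s t v
    exact Formula.realize_rel₂.trans Iff.rfl
  have hV : ∀ (s t : L2.Term (V m)) (v : V m → Fin n), (ltV s t).Realize v ↔ σ (s.realize v) < σ (t.realize v) := by
    intro s t v
    exact Formula.realize_rel₂.trans Iff.rfl
  have hG : ∀ (s t : L2.Term (V m)) (v : V m → Fin n), (graph τ s t).Realize v ↔
      ((∃ i, s.realize v = v (.inl (.inr i)) ∧ t.realize v = v (.inl (.inr (τ i)))) ∨
       ((∀ i, s.realize v ≠ v (.inl (.inr i))) ∧ t.realize v = s.realize v)) := by
    intro s t v
    simp only [graph, Formula.realize_sup, Formula.realize_inf, Formula.realize_iSup,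
      Formula.realize_iInf, Formula.realize_not, Formula.realize_equal, vx, Term.realize_var, ne_eq]
  have hI : ∀ (v : V m → Fin n), (inj m).Realize v ↔
      ∀ i j, i ≠ j → v (.inl (.inr i)) ≠ v (.inl (.inr j)) := by
    intro v
    simp only [inj, Formula.realize_iInf, Prod.forall]
    refine forall_congr' fun i => forall_congr' fun j => ?_
    by_cases h : i = j
    · simp [h]
    · simp [h, vx, Formula.realize_not, Formula.realize_equal]
  refine (Formula.realize_iExs (φ := Formula.iAlls (Fin 4) (body τ)) (v := default)).trans ?_
  refine exists_congr fun x => ?_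
  rw [Formula.realize_iAlls]
  refine forall_congr' fun y => ?_
  simp only [body, Formula.realize_inf, Formula.realize_imp, Formula.realize_iff, hP, hV, hG, hI,
    vy, Term.realize_var, Sum.elim_inl, Sum.elim_inr]

lemma sat_sent' {m n : ℕ} (τ : Equiv.Perm (Fin m)) (σ : Equiv.Perm (Fin n)) :
    Sat2 σ (sent τ) ↔ ∃ x : Fin m ↪ Fin n, σ = τ.viaFintypeEmbedding x := by
  have key : ∀ (x : Fin m ↪ Fin n) a b, ((∃ i, a = x i ∧ b = x (τ i)) ∨ ((∀ i, a ≠ x i) ∧ b = a))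
      ↔ b = τ.viaFintypeEmbedding x a := by
    intro x a b
    by_cases h : a ∈ Set.range x
    · obtain ⟨i, rfl⟩ := h
      simp [Equiv.Perm.viaFintypeEmbedding_apply_image]
    · rw [Equiv.Perm.viaFintypeEmbedding_apply_notMem_range _ _ h]
      have h' : ∀ i, a ≠ x i := fun i hi => h ⟨i, hi.symm⟩
      simp [h']
  rw [sat_sent]
  constructor
  · rintro ⟨x, hx⟩
    by_cases hn : Nonempty (Fin n)
    · obtain ⟨z⟩ := hn
      let x' : Fin m ↪ Fin n := ⟨x, fun i j hij => by
        by_contra h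
        exact (hx fun _ => z).1 i j h hij⟩
      refine ⟨x', perm_eq_of_lt _ _ fun a b => ?_⟩
      have := (hx ![a, b, τ.viaFintypeEmbedding x' a, τ.viaFintypeEmbedding x' b]).2
      exact this ⟨(key x' _ _).2 rfl, (key x' _ _).2 rfl⟩
    · have hn' : IsEmpty (Fin n) := not_nonempty_iff.1 hn
      exact ⟨⟨x, fun i => hn'.elim (x i)⟩, Equiv.ext fun i => hn'.elim i⟩
  · rintro ⟨x, rfl⟩
    refine ⟨x, fun y => ⟨fun i j h => x.injective.ne h, ?_⟩⟩
    rw [key, key]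
    rintro ⟨h1, h2⟩
    rw [h1, h2]

lemma cycleType_via {m n : ℕ} (τ : Equiv.Perm (Fin m)) (x : Fin m ↪ Fin n) :
    (τ.viaFintypeEmbedding x).cycleType = τ.cycleType :=
  Equiv.Perm.cycleType_extendDomain _

lemma exists_via {m n : ℕ} (τ : Equiv.Perm (Fin m)) (σ : Equiv.Perm (Fin n)) :
    (∃ x : Fin m ↪ Fin n, σ = τ.viaFintypeEmbedding x) ↔ σ.cycleType = τ.cycleType ∧ m ≤ n := by
  constructor
  · rintro ⟨x, rfl⟩
    exact ⟨cycleType_via τ x, by simpa using Fintype.card_le_of_embedding x⟩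
  · rintro ⟨h, hmn⟩
    let x0 : Fin m ↪ Fin n := Fin.castLEEmb hmn
    have : IsConj (τ.viaFintypeEmbedding x0) σ := by
      rw [Equiv.Perm.isConj_iff_cycleType_eq, cycleType_via, h]
    obtain ⟨g, hg⟩ := isConj_iff.1 this
    refine ⟨x0.trans g.toEmbedding, ?_⟩
    rw [← hg]
    ext a
    congr 1
    obtain ⟨b, rfl⟩ := g.surjective a
    by_cases hb : b ∈ Set.range x0
    · obtain ⟨i, rfl⟩ := hb
      have := Equiv.Perm.viaFintypeEmbedding_apply_image τ (x0.trans g.toEmbedding) i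
      simp only [Function.Embedding.trans_apply, Equiv.coe_toEmbedding] at this
      rw [this]
      simp [Equiv.Perm.viaFintypeEmbedding_apply_image]
    · rw [Equiv.Perm.viaFintypeEmbedding_apply_notMem_range]
      · simp [Equiv.Perm.viaFintypeEmbedding_apply_notMem_range _ _ hb]
      · rintro ⟨i, hi⟩
        exact hb ⟨i, g.injective hi⟩

lemma full_iff {n : ℕ} (lam : Multiset ℕ) (σ : Equiv.Perm (Fin n)) :
    (∃ k, fullCycleType σ = lam + Multiset.replicate k 1) ↔
      σ.cycleType = lam.filter (· ≠ 1) ∧ lam.sum ≤ n := by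
  have hs : σ.support.card ≤ n := by simpa using Finset.card_le_univ σ.support
  have h1 : ∀ k, (Multiset.replicate k 1).filter (· ≠ 1) = 0 := by
    intro k
    rw [Multiset.filter_eq_nil]
    intro a ha
    simp [Multiset.eq_of_mem_replicate ha]
  have h2 : σ.cycleType.filter (· ≠ 1) = σ.cycleType := by
    rw [Multiset.filter_eq_self]
    intro a ha
    have := Equiv.Perm.two_le_of_mem_cycleType ha
    omega
  have hl : lam = lam.filter (· ≠ 1) + Multiset.replicate (lam.count 1) 1 := by
    conv_lhs => rw [← Multiset.filter_add_not (· ≠ 1) lam]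
    congr 1
    simp [Multiset.filter_eq']
  unfold fullCycleType
  constructor
  · rintro ⟨k, hk⟩
    constructor
    · have := congrArg (Multiset.filter (· ≠ 1)) hk
      rwa [Multiset.filter_add, Multiset.filter_add, h1, h1, h2, add_zero, add_zero] at this
    · have := congrArg Multiset.sum hk
      simp [Equiv.Perm.sum_cycleType] at this
      omega
  · rintro ⟨h, hle⟩
    have e1 : lam.sum = (lam.filter (· ≠ 1)).sum + lam.count 1 := by
      conv_lhs => rw [hl]
      simp
    have e2 : (lam.filter (· ≠ 1)).sum = σ.support.card := by
      rw [← h, Equiv.Perm.sum_cycleType]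
    refine ⟨n - lam.sum, ?_⟩
    rw [h]
    conv_rhs => rw [hl]
    rw [add_assoc, ← Multiset.replicate_add]
    congr 2
    rw [← hl]
    omega

end TotoAux

theorem dLambda_TOTO_definable (lam : Multiset ℕ) (hlam : ∀ i ∈ lam, 0 < i) :
    TOTODef {p : Perms |
      ∃ k : ℕ, fullCycleType p.2 = lam + Multiset.replicate k 1} := by
  obtain ⟨τ, hτ⟩ : ∃ τ : Equiv.Perm (Fin lam.sum), τ.cycleType = lam.filter (· ≠ 1) := by
    rw [Equiv.Perm.exists_with_cycleType_iff]
    constructor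
    · rw [Fintype.card_fin]
      conv_rhs => rw [← Multiset.filter_add_not (· ≠ 1) lam]
      simp
    · intro a ha
      rw [Multiset.mem_filter] at ha
      have := hlam a ha.1
      omega
  refine ⟨TotoAux.sent τ, fun n σ => ?_⟩
  rw [TotoAux.sat_sent', TotoAux.exists_via, hτ]
  exact (TotoAux.full_iff lam σ).symm
end

section
/- There is no L2-sentence φ such that for every n and every permutation σ of {1,…,n}, M_σ satisfies φ if and only if σ has a fixed point (an index i with σ(i) = i). -/
open FirstOrder

/-- Back-and-forth system: pairs of integers whose differences agree up to the threshold `2^q`. -/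
def SimQ (q : ℕ) (R : Finset (ℤ × ℤ)) : Prop :=
  ∀ p ∈ R, ∀ r ∈ R, p.1 - r.1 = p.2 - r.2 ∨
    ((2:ℤ)^q ≤ p.1 - r.1 ∧ (2:ℤ)^q ≤ p.2 - r.2) ∨
    ((2:ℤ)^q ≤ r.1 - p.1 ∧ (2:ℤ)^q ≤ r.2 - p.2)

theorem SimQ.mono {q q' : ℕ} (h : q ≤ q') {R : Finset (ℤ × ℤ)} (hR : SimQ q' R) : SimQ q R := by
  have : (2:ℤ)^q ≤ 2^q' := pow_le_pow_right₀ (by norm_num) h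
  intro p hp r hr
  have := hR p hp r hr
  omega

theorem SimQ.swap {q : ℕ} {R : Finset (ℤ × ℤ)} (hR : SimQ q R) : SimQ q (R.image Prod.swap) := by
  intro p hp r hr
  simp only [Finset.mem_image] at hp hr
  obtain ⟨p, hp, rfl⟩ := hp
  obtain ⟨r, hr, rfl⟩ := hr
  have := hR p hp r hr
  simp only [Prod.fst_swap, Prod.snd_swap]
  omega

theorem SimQ.insert {q : ℕ} {R : Finset (ℤ × ℤ)} (hR : SimQ q R) (c d : ℤ)
    (h : ∀ p ∈ R, p.1 - c = p.2 - d ∨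
    ((2:ℤ)^q ≤ p.1 - c ∧ (2:ℤ)^q ≤ p.2 - d) ∨
    ((2:ℤ)^q ≤ c - p.1 ∧ (2:ℤ)^q ≤ d - p.2)) : SimQ q (insert (c, d) R) := by
  intro p hp r hr
  rw [Finset.mem_insert] at hp hr
  rcases hp with rfl | hp <;> rcases hr with rfl | hr
  · left; simp
  · have := h r hr
    simp only
    omega
  · exact h p hp
  · exact hR p hp r hr

theorem SimQ.ext {q : ℕ} {R : Finset (ℤ × ℤ)} (hR : SimQ (q+1) R) {lo hi : ℤ × ℤ}
    (hlo : lo ∈ R) (hhi : hi ∈ R) (c : ℤ) (h1 : lo.1 < c) (h2 : c < hi.1) :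
    ∃ d, lo.2 < d ∧ d < hi.2 ∧ SimQ q (Insert.insert (c, d) R) := by
  have hpos : (0:ℤ) < 2^q := by positivity
  have hs : (2:ℤ)^(q+1) = 2 * 2^q := by ring
  suffices ∃ d, SimQ q (Insert.insert (c, d) R) by
    obtain ⟨d, hd⟩ := this
    have a1 := hd (c, d) (by simp) lo (by simp [hlo])
    have a2 := hd (c, d) (by simp) hi (by simp [hhi])
    simp only at a1 a2
    exact ⟨d, by omega, by omega, hd⟩
  have hR' := hR.mono (Nat.le_succ q)
  by_cases hc : ∃ w ∈ R, |c - w.1| < 2^q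
  · obtain ⟨w, hw, hlt⟩ := hc
    rw [abs_lt] at hlt
    refine ⟨w.2 + (c - w.1), hR'.insert _ _ fun p hp => ?_⟩
    have := hR p hp w hw
    omega
  · push Not at hc
    have hc' : ∀ w ∈ R, 2^q ≤ c - w.1 ∨ 2^q ≤ w.1 - c := by
      intro w hw
      have := hc w hw
      rcases le_abs.1 this with h | h <;> omega
    obtain ⟨u, hu, humax⟩ := Finset.exists_max_image (R.filter fun p => p.1 < c) Prod.fst
      ⟨lo, by simp [hlo, h1]⟩
    obtain ⟨v, hv, hvmin⟩ := Finset.exists_min_image (R.filter fun p => c < p.1) Prod.fst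
      ⟨hi, by simp [hhi, h2]⟩
    simp only [Finset.mem_filter] at hu hv humax hvmin
    refine ⟨u.2 + 2^q, hR'.insert _ _ fun p hp => ?_⟩
    have k1 := hR p hp u hu.1
    have k2 := hR p hp v hv.1
    have k3 := hR v hv.1 u hu.1
    have k4 := hc' p hp
    have k5 := hc' u hu.1
    have k6 := hc' v hv.1
    have k7 := fun h => humax p ⟨hp, h⟩
    have k8 := fun h => hvmin p ⟨hp, h⟩
    rcases k4 with k4 | k4
    · have := k7 (by omega)
      omega
    · have := k8 (by omega)
      omega

theorem L2_term {k : ℕ} (t : L2.Term (Empty ⊕ Fin k)) : ∃ i, t = .var (Sum.inr i) := by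
  cases t with
  | var x =>
    rcases x with x | i
    · exact x.elim
    · exact ⟨i, rfl⟩
  | func f => exact Empty.elim f

/-- Term realization in the reversed order. -/
def RevTerm (n : ℕ) {k : ℕ} (t : L2.Term (Empty ⊕ Fin k)) (xs : Fin k → Fin n) : Fin n :=
  letI := permStruc2 (Fin.revPerm (n := n))
  t.realize (Sum.elim (default : Empty → Fin n) xs)

/-- Realization in the reversed order. -/
def RevReal (n : ℕ) {k : ℕ} (φ : L2.BoundedFormula Empty k) (xs : Fin k → Fin n) : Prop :=
  letI := permStruc2 (Fin.revPerm (n := n))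
  φ.Realize (default : Empty → Fin n) xs

theorem rev_main {k : ℕ} (φ : L2.BoundedFormula Empty k) :
    ∃ q : ℕ, ∀ (n n' : ℕ) (xs : Fin k → Fin n) (ys : Fin k → Fin n') (R : Finset (ℤ × ℤ)),
      SimQ q R → ((-1, -1) : ℤ × ℤ) ∈ R → ((n, n') : ℤ × ℤ) ∈ R →
      (∀ i, (((xs i : ℕ), (ys i : ℕ)) : ℤ × ℤ) ∈ R) →
      (RevReal n φ xs ↔ RevReal n' φ ys) := by
  induction φ with
  | falsum => exact ⟨0, fun _ _ _ _ _ _ _ _ _ => Iff.rfl⟩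
  | equal t₁ t₂ =>
    obtain ⟨i, rfl⟩ := L2_term t₁
    obtain ⟨j, rfl⟩ := L2_term t₂
    refine ⟨0, fun n n' xs ys R hR _ _ h => ?_⟩
    have := hR _ (h i) _ (h j)
    change xs i = xs j ↔ ys i = ys j
    simp only [Fin.ext_iff]
    simp only [pow_zero] at this
    omega
  | rel r ts =>
    refine ⟨0, fun n n' xs ys R hR _ _ h => ?_⟩
    cases r with
    | ltP =>
      obtain ⟨i, hi⟩ := L2_term (ts 0)
      obtain ⟨j, hj⟩ := L2_term (ts 1)
      have := hR _ (h i) _ (h j)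
      change RevTerm n (ts 0) xs < RevTerm n (ts 1) xs ↔
        RevTerm n' (ts 0) ys < RevTerm n' (ts 1) ys
      rw [hi, hj]
      change xs i < xs j ↔ ys i < ys j
      simp only [Fin.lt_def]
      simp only [pow_zero] at this
      omega
    | ltV =>
      obtain ⟨i, hi⟩ := L2_term (ts 0)
      obtain ⟨j, hj⟩ := L2_term (ts 1)
      have := hR _ (h i) _ (h j)
      change Fin.rev (RevTerm n (ts 0) xs) < Fin.rev (RevTerm n (ts 1) xs) ↔
        Fin.rev (RevTerm n' (ts 0) ys) < Fin.rev (RevTerm n' (ts 1) ys)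
      rw [hi, hj]
      change Fin.rev (xs i) < Fin.rev (xs j) ↔ Fin.rev (ys i) < Fin.rev (ys j)
      rw [Fin.rev_lt_rev, Fin.rev_lt_rev, Fin.lt_def, Fin.lt_def]
      simp only [pow_zero] at this
      omega
  | imp f g ihf ihg =>
    obtain ⟨q1, h1⟩ := ihf
    obtain ⟨q2, h2⟩ := ihg
    refine ⟨max q1 q2, fun n n' xs ys R hR a b h => ?_⟩
    have e1 := h1 n n' xs ys R (hR.mono (le_max_left _ _)) a b h
    have e2 := h2 n n' xs ys R (hR.mono (le_max_right _ _)) a b h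
    change (RevReal n f xs → RevReal n g xs) ↔ (RevReal n' f ys → RevReal n' g ys)
    rw [e1, e2]
  | @all k f ih =>
    obtain ⟨q, hq⟩ := ih
    refine ⟨q + 1, fun n n' xs ys R hR a b h => ?_⟩
    change (∀ x, RevReal n f (Fin.snoc xs x)) ↔ (∀ y, RevReal n' f (Fin.snoc ys y))
    have key : ∀ (x : Fin n) (y : Fin n'),
        SimQ q (insert (((x : ℕ) : ℤ), ((y : ℕ) : ℤ)) R) →
        (RevReal n f (Fin.snoc xs x) ↔ RevReal n' f (Fin.snoc ys y)) := by
      intro x y hS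
      refine hq n n' _ _ _ hS (Finset.mem_insert_of_mem a) (Finset.mem_insert_of_mem b) ?_
      intro i
      refine Fin.lastCases ?_ (fun i => ?_) i
      · simp
      · simp only [Fin.snoc_castSucc]
        exact Finset.mem_insert_of_mem (h i)
    constructor
    · intro H y
      have hsw := hR.swap
      obtain ⟨d, hd1, hd2, hS⟩ := hsw.ext (lo := (-1, -1)) (hi := (n', n))
        (Finset.mem_image.2 ⟨_, a, rfl⟩) (Finset.mem_image.2 ⟨_, b, rfl⟩) ((y : ℕ) : ℤ)
        (by simp only; omega) (by simp only; omega)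
      simp only at hd1 hd2
      lift d to ℕ using by omega
      have hS' := hS.swap
      rw [Finset.image_insert, Finset.image_image] at hS'
      simp only [Prod.swap_swap_eq, Finset.image_id, Prod.swap_prod_mk] at hS'
      exact (key ⟨d, by omega⟩ y hS').1 (H _)
    · intro H x
      obtain ⟨d, hd1, hd2, hS⟩ := hR.ext a b ((x : ℕ) : ℤ)
        (by simp only; omega) (by simp only; omega)
      simp only at hd1 hd2
      lift d to ℕ using by omega
      exact (key x ⟨d, by omega⟩ hS).2 (H _)

theorem exists_fixed_point_not_TOTO_expressible :
    ¬ ∃ φ : L2.Sentence, ∀ (n : ℕ) (σ : Equiv.Perm (Fin n)),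
        Sat2 σ φ ↔ ∃ i : Fin n, σ i = i := by
  rintro ⟨φ, hφ⟩
  obtain ⟨q, hq⟩ := rev_main φ
  have hpos : (0:ℤ) < 2^q := by positivity
  have hsat : ∀ n (xs : Fin 0 → Fin n), RevReal n φ xs ↔ ∃ i : Fin n, Fin.rev i = i := by
    intro n xs
    refine Iff.trans ?_ (hφ n Fin.revPerm)
    unfold Sat2 RevReal FirstOrder.Language.Sentence.Realize FirstOrder.Language.Formula.Realize
    rw [Subsingleton.elim xs default]
  have hS : SimQ q {((-1, -1) : ℤ × ℤ),
      (((2 * 2^q : ℕ) : ℤ), ((2 * 2^q + 1 : ℕ) : ℤ))} := by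
    intro p hp r hr
    simp only [Finset.mem_insert, Finset.mem_singleton] at hp hr
    rcases hp with rfl | rfl <;> rcases hr with rfl | rfl <;> dsimp only <;> push_cast <;>
      generalize (2:ℤ)^q = z at * <;> first | omega | exact Or.inl trivial
  have e := hq (2 * 2^q) (2 * 2^q + 1) Fin.elim0 Fin.elim0 _ hS (by simp) (by simp)
    (fun i => i.elim0)
  rw [hsat, hsat] at e
  obtain ⟨i, hi⟩ := e.2 ⟨⟨2^q, by omega⟩, by
    rw [Fin.ext_iff, Fin.val_rev]
    simp only
    omega⟩
  rw [Fin.ext_iff, Fin.val_rev] at hi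
  omega
end

section
/- Let C be a permutation class. The following are equivalent: (1) there exists an L2-sentence ψ such that for every σ ∈ C, M_σ satisfies ψ if and only if σ has a fixed point; (2) there exists an L2-formula φ(x) with one free variable such that for every σ ∈ C and every element a, φ(a) holds in M_σ if and only if σ(a) = a; (3) there exist positive integers k, m, n such that neither δ_k nor 321[inc_m,1,inc_n] belongs to C. -/
open FirstOrder

/-- A permutation class: a set of permutations closed under taking patterns. -/
def PermClass (C : Set Perms) : Prop :=
  ∀ p : Perms, p ∈ C → ∀ q : Perms, (∃ a, IsOccurrence q.2 p.2 a) → q ∈ C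

def pat321Fun (m n : ℕ) (p : Fin (m + n + 1)) : Fin (m + n + 1) :=
  if _ : (p : ℕ) < m then ⟨n + 1 + p, by omega⟩
  else if _ : (p : ℕ) = m then ⟨n, by omega⟩
  else ⟨(p : ℕ) - m - 1, by have := p.isLt; omega⟩

theorem pat321Fun_injective (m n : ℕ) : Function.Injective (pat321Fun m n) := by
  intro p q h
  have hp := p.isLt
  have hq := q.isLt
  unfold pat321Fun at h
  apply Fin.ext
  split_ifs at h <;> simp only [Fin.mk.injEq] at h <;> omega

/-- The permutation `321[inc_m, 1, inc_n]` of size `m + n + 1`: with positions and values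
`0`-indexed, positions `0,…,m-1` are sent to `n+1,…,n+m`, position `m` to `n`, and
positions `m+1,…,m+n` to `0,…,n-1`. -/
noncomputable def pat321 (m n : ℕ) : Equiv.Perm (Fin (m + n + 1)) :=
  Equiv.ofBijective _ (Finite.injective_iff_bijective.mp (pat321Fun_injective m n))

/-! ### Ehrenfeucht-Fraisse part -/

/-- Two integers agree up to threshold `t`. -/
def ThrClose (t u v : ℤ) : Prop := u = v ∨ (t ≤ u ∧ t ≤ v) ∨ (u ≤ -t ∧ v ≤ -t)

/-- All distances agree up to threshold `t`. -/
def ThrGood (t : ℤ) (S : Set (ℤ × ℤ)) : Prop :=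
  ∀ p ∈ S, ∀ p' ∈ S, ThrClose t (p.1 - p'.1) (p.2 - p'.2)

theorem ThrGood.mono {t t' : ℤ} {S S' : Set (ℤ × ℤ)} (h : ThrGood t' S') (ht : t ≤ t')
    (hS : S ⊆ S') : ThrGood t S := by
  intro p hp p' hp'
  have := h p (hS hp) p' (hS hp')
  unfold ThrClose at *
  omega

theorem ThrGood.insert {t : ℤ} {S : Set (ℤ × ℤ)} (h : ThrGood t S) (c d : ℤ)
    (H : ∀ p ∈ S, ThrClose t (p.1 - c) (p.2 - d)) : ThrGood t (insert (c, d) S) := by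
  intro p hp p' hp'
  rcases hp with rfl | hp <;> rcases hp' with rfl | hp'
  · left; simp
  · have := H p' hp'
    unfold ThrClose at *
    dsimp only
    omega
  · exact H p hp
  · exact h p hp p' hp'

theorem ThrGood.extend {t : ℤ} (ht : 1 ≤ t) {S : Set (ℤ × ℤ)} (hS : S.Finite)
    (h : ThrGood (2 * t) S) (c : ℤ) (hl : ∃ p ∈ S, p.1 ≤ c) :
    ∃ d, ThrGood t (Insert.insert (c, d) S) := by
  have h1 : ThrGood t S := h.mono (by omega) subset_rfl
  by_cases hn : ∃ p ∈ S, -t < p.1 - c ∧ p.1 - c < t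
  · obtain ⟨p, hp, hp1, hp2⟩ := hn
    refine ⟨p.2 + (c - p.1), h1.insert _ _ ?_⟩
    intro p' hp'
    have := h p' hp' p hp
    unfold ThrClose at *
    omega
  · push Not at hn
    obtain ⟨l, hl, hlc⟩ := hl
    obtain ⟨m, hm, hmax⟩ := Set.exists_max_image {p ∈ S | p.1 ≤ c} Prod.fst
      (hS.subset (Set.sep_subset _ _)) ⟨l, hl, hlc⟩
    refine ⟨m.2 + t, h1.insert _ _ ?_⟩
    intro p' hp'
    have e1 := h p' hp' m hm.1
    have e2 := hn p' hp'
    have e3 := hn m hm.1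
    have e4 := hm.2
    by_cases hc : p'.1 ≤ c
    · have := hmax p' ⟨hp', hc⟩
      unfold ThrClose at *
      omega
    · unfold ThrClose at *
      omega

/-- The swap of a set of pairs. -/
theorem ThrGood.swap {t : ℤ} {S : Set (ℤ × ℤ)} (h : ThrGood t S) : ThrGood t (Prod.swap '' S) := by
  rintro _ ⟨p, hp, rfl⟩ _ ⟨p', hp', rfl⟩
  have := h p hp p' hp'
  unfold ThrClose at *
  simp only [Prod.fst_swap, Prod.snd_swap]
  omega

/-- Quantifier depth. -/
def qdepth : ∀ {k : ℕ}, L2.BoundedFormula Empty k → ℕ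
  | _, .falsum => 0
  | _, .equal _ _ => 0
  | _, .rel _ _ => 0
  | _, .imp f g => max (qdepth f) (qdepth g)
  | _, .all f => qdepth f + 1

/-- The set of pairs for two tuples. -/
def pairSet {N N' k : ℕ} (S : Set (ℤ × ℤ)) (x : Fin k → Fin N) (y : Fin k → Fin N') :
    Set (ℤ × ℤ) := S ∪ Set.range (fun i => (((x i : ℕ) : ℤ), ((y i : ℕ) : ℤ)))

theorem pairSet_snoc {N N' k : ℕ} (S : Set (ℤ × ℤ)) (x : Fin k → Fin N) (y : Fin k → Fin N')
    (c : Fin N) (d : Fin N') :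
    pairSet S (Fin.snoc x c : Fin (k+1) → Fin N) (Fin.snoc y d : Fin (k+1) → Fin N') =
      insert (((c : ℕ) : ℤ), ((d : ℕ) : ℤ)) (pairSet S x y) := by
  ext p
  simp only [pairSet, Set.mem_union, Set.mem_range, Set.mem_insert_iff]
  constructor
  · rintro (h | ⟨i, rfl⟩)
    · exact Or.inr (Or.inl h)
    · refine Fin.lastCases ?_ (fun i => ?_) i
      · left; simp
      · right; right; exact ⟨i, by simp⟩
  · rintro (rfl | h | ⟨i, rfl⟩)
    · exact Or.inr ⟨Fin.last _, by simp⟩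
    · exact Or.inl h
    · exact Or.inr ⟨i.castSucc, by simp⟩

theorem pairSet_swap {N N' k : ℕ} (S : Set (ℤ × ℤ)) (x : Fin k → Fin N) (y : Fin k → Fin N') :
    Prod.swap '' (pairSet S x y) = pairSet (Prod.swap '' S) y x := by
  unfold pairSet
  rw [Set.image_union, ← Set.range_comp]
  rfl

theorem pairSet_extend {N N' k : ℕ} {S : Set (ℤ × ℤ)} (hS : S.Finite)
    (h0 : ((-1 : ℤ), (-1 : ℤ)) ∈ S) (h1 : ((N : ℤ), (N' : ℤ)) ∈ S)
    (x : Fin k → Fin N) (y : Fin k → Fin N') {t : ℤ} (ht : 1 ≤ t)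
    (h : ThrGood (2 * t) (pairSet S x y)) (c : Fin N) :
    ∃ d : Fin N', ThrGood t
      (pairSet S (Fin.snoc x c : Fin (k+1) → Fin N) (Fin.snoc y d : Fin (k+1) → Fin N')) := by
  obtain ⟨d, hd⟩ := h.extend ht (hS.union (Set.finite_range _)) (c : ℕ)
    ⟨_, Or.inl h0, by dsimp only; omega⟩
  have e0 := hd _ (Or.inr (Or.inl h0)) _ (Or.inl rfl)
  have e1 := hd _ (Or.inr (Or.inl h1)) _ (Or.inl rfl)
  have hc := c.isLt
  unfold ThrClose at e0 e1
  dsimp only at e0 e1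
  have hd0 : 0 ≤ d := by omega
  obtain ⟨d, rfl⟩ := Int.eq_ofNat_of_zero_le hd0
  refine ⟨⟨d, by omega⟩, ?_⟩
  rw [pairSet_snoc]
  exact hd

theorem L2_term_s15 {α : Type} (t : L2.Term α) : ∃ a, t = .var a := by
  cases t with
  | var a => exact ⟨a, rfl⟩
  | func f _ => exact Empty.elim f

/-- Atomic compatibility. -/
def AtomOK {N N' : ℕ} (σ : Equiv.Perm (Fin N)) (τ : Equiv.Perm (Fin N')) (S : Set (ℤ × ℤ)) :
    Prop :=
  ∀ (x y : Fin N) (x' y' : Fin N'), ThrGood 1 (pairSet S ![x, y] ![x', y']) →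
    (σ x < σ y ↔ τ x' < τ y')

theorem EF_main {N N' : ℕ} (σ : Equiv.Perm (Fin N)) (τ : Equiv.Perm (Fin N'))
    {S : Set (ℤ × ℤ)} (hS : S.Finite)
    (h0 : ((-1 : ℤ), (-1 : ℤ)) ∈ S) (h1 : ((N : ℤ), (N' : ℤ)) ∈ S) (hat : AtomOK σ τ S)
    {k : ℕ} (φ : L2.BoundedFormula Empty k) : ∀ (q : ℕ), qdepth φ ≤ q →
    ∀ (x : Fin k → Fin N) (y : Fin k → Fin N'), ThrGood (2 ^ q) (pairSet S x y) →
    ((letI := permStruc2 σ; φ.Realize (default : Empty → Fin N) x) ↔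
      (letI := permStruc2 τ; φ.Realize (default : Empty → Fin N') y)) := by
  let _ := permStruc2 σ
  let _ := permStruc2 τ
  induction φ with
  | falsum => intros; rfl
  | equal t₁ t₂ =>
    intro q _ x y h
    obtain ⟨a, rfl⟩ := L2_term_s15 t₁
    obtain ⟨b, rfl⟩ := L2_term_s15 t₂
    rcases a with a | a
    · exact a.elim
    rcases b with b | b
    · exact b.elim
    have e := h _ (Or.inr ⟨a, rfl⟩) _ (Or.inr ⟨b, rfl⟩)
    have ht : (1 : ℤ) ≤ 2 ^ q := one_le_pow₀ (by norm_num)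
    change x a = x b ↔ y a = y b
    unfold ThrClose at e
    dsimp only at e
    rw [Fin.ext_iff, Fin.ext_iff]
    omega
  | rel R ts =>
    intro q _ x y h
    have ht : (1 : ℤ) ≤ 2 ^ q := one_le_pow₀ (by norm_num)
    cases R with
    | ltP =>
      obtain ⟨a, ha⟩ := L2_term_s15 (ts 0)
      obtain ⟨b, hb⟩ := L2_term_s15 (ts 1)
      rcases a with a | a
      · exact a.elim
      rcases b with b | b
      · exact b.elim
      have e := h _ (Or.inr ⟨a, rfl⟩) _ (Or.inr ⟨b, rfl⟩)
      change (ts 0).realize (Sum.elim default x) < (ts 1).realize (Sum.elim default x) ↔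
        (ts 0).realize (Sum.elim default y) < (ts 1).realize (Sum.elim default y)
      rw [ha, hb]
      change x a < x b ↔ y a < y b
      unfold ThrClose at e
      dsimp only at e
      rw [Fin.lt_def, Fin.lt_def]
      omega
    | ltV =>
      obtain ⟨a, ha⟩ := L2_term_s15 (ts 0)
      obtain ⟨b, hb⟩ := L2_term_s15 (ts 1)
      rcases a with a | a
      · exact a.elim
      rcases b with b | b
      · exact b.elim
      change σ ((ts 0).realize (Sum.elim default x)) < σ ((ts 1).realize (Sum.elim default x)) ↔
        τ ((ts 0).realize (Sum.elim default y)) < τ ((ts 1).realize (Sum.elim default y))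
      rw [ha, hb]
      change σ (x a) < σ (x b) ↔ τ (y a) < τ (y b)
      refine hat _ _ _ _ (h.mono ht ?_)
      rintro p (hp | ⟨i, rfl⟩)
      · exact Or.inl hp
      · right
        fin_cases i
        · exact ⟨a, rfl⟩
        · exact ⟨b, rfl⟩
  | imp f g ihf ihg =>
    intro q hq x y h
    have hq' : max (qdepth f) (qdepth g) ≤ q := hq
    exact imp_congr (ihf q (le_trans (le_max_left _ _) hq') x y h)
      (ihg q (le_trans (le_max_right _ _) hq') x y h)
  | all f ih =>
    intro q hq x y h
    have hq' : qdepth f + 1 ≤ q := hq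
    obtain ⟨q, rfl⟩ : ∃ q', q = q' + 1 := ⟨q - 1, by omega⟩
    have ht : (1 : ℤ) ≤ 2 ^ q := one_le_pow₀ (by norm_num)
    rw [pow_succ, mul_comm] at h
    constructor
    · intro H d
      have hs := h.swap
      rw [pairSet_swap] at hs
      obtain ⟨c, hc⟩ := pairSet_extend (hS.image _) ⟨_, h0, rfl⟩ ⟨_, h1, rfl⟩ y x ht hs d
      have hs' := hc.swap
      rw [pairSet_swap, ← Set.image_comp, Prod.swap_swap_eq, Set.image_id] at hs'
      exact (ih q (by omega) _ _ hs').1 (H c)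
    · intro H c
      obtain ⟨d, hd⟩ := pairSet_extend hS h0 h1 x y ht h c
      exact (ih q (by omega) _ _ hd).2 (H d)

theorem EF_sat {N N' : ℕ} (σ : Equiv.Perm (Fin N)) (τ : Equiv.Perm (Fin N'))
    {S : Set (ℤ × ℤ)} (hS : S.Finite)
    (h0 : ((-1 : ℤ), (-1 : ℤ)) ∈ S) (h1 : ((N : ℤ), (N' : ℤ)) ∈ S) (hat : AtomOK σ τ S)
    (ψ : L2.Sentence) (h : ThrGood (2 ^ qdepth ψ) S) : Sat2 σ ψ ↔ Sat2 τ ψ := by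
  have := EF_main σ τ hS h0 h1 hat ψ (qdepth ψ) le_rfl (default : Fin 0 → Fin N) 
    (default : Fin 0 → Fin N') (by
      refine h.mono le_rfl ?_
      rintro p (hp | ⟨i, _⟩)
      · exact hp
      · exact i.elim0)
  exact this

theorem rev_fixed (k : ℕ) : (∃ i : Fin k, Fin.revPerm i = i) ↔ k % 2 = 1 := by
  constructor
  · rintro ⟨i, hi⟩
    rw [Fin.ext_iff, Fin.revPerm_apply, Fin.val_rev] at hi
    omega
  · intro h
    refine ⟨⟨k / 2, by omega⟩, ?_⟩
    rw [Fin.ext_iff, Fin.revPerm_apply, Fin.val_rev]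
    dsimp only
    omega

theorem rev_equiv (ψ : L2.Sentence) (k : ℕ) (hk : 2 ^ qdepth ψ ≤ k) :
    Sat2 (Fin.revPerm : Equiv.Perm (Fin k)) ψ ↔
      Sat2 (Fin.revPerm : Equiv.Perm (Fin (k+1))) ψ := by
  have hk' : (2 : ℤ) ^ qdepth ψ ≤ k := by exact_mod_cast hk
  refine EF_sat _ _ (S := {(-1, -1), ((k : ℤ), ((k + 1 : ℕ) : ℤ))}) (by simp) (by simp) (by simp)
    ?_ ψ ?_
  · intro x y x' y' h
    have e := h _ (Or.inr ⟨0, rfl⟩) _ (Or.inr ⟨1, rfl⟩)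
    unfold ThrClose at e
    simp at e
    simp only [Fin.revPerm_apply, Fin.rev_lt_rev]
    rw [Fin.lt_def, Fin.lt_def]
    omega
  · clear hk
    generalize (2 : ℤ) ^ qdepth ψ = T at hk' ⊢
    rintro p (rfl | rfl) p' (rfl | rfl) <;> unfold ThrClose <;> dsimp only <;> omega

theorem pat_val (m n : ℕ) (p : Fin (m + n + 1)) : ((pat321 m n p : Fin (m+n+1)) : ℕ) =
    if (p : ℕ) < m then n + 1 + p else if (p : ℕ) = m then n else p - m - 1 := by
  change ((pat321Fun m n p : Fin (m+n+1)) : ℕ) = _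
  unfold pat321Fun
  split_ifs <;> rfl

theorem pat_fixed (m n : ℕ) : (∃ i, pat321 m n i = i) ↔ m = n := by
  constructor
  · rintro ⟨i, hi⟩
    rw [Fin.ext_iff, pat_val] at hi
    split_ifs at hi <;> omega
  · rintro rfl
    refine ⟨⟨m, by omega⟩, ?_⟩
    rw [Fin.ext_iff, pat_val]
    simp

theorem pat_equiv (ψ : L2.Sentence) (k : ℕ) (hk : 2 ^ qdepth ψ ≤ k) :
    Sat2 (pat321 k k) ψ ↔ Sat2 (pat321 k (k+1)) ψ := by
  have hk' : (2 : ℤ) ^ qdepth ψ ≤ k := by exact_mod_cast hk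
  refine EF_sat _ _ (S := {(-1, -1), ((k : ℤ), (k : ℤ)),
    (((k + k + 1 : ℕ) : ℤ), ((k + (k + 1) + 1 : ℕ) : ℤ))}) (by simp) (by simp) (by simp)
    ?_ ψ ?_
  · intro x y x' y' h
    have e := h _ (Or.inr ⟨0, rfl⟩) _ (Or.inr ⟨1, rfl⟩)
    have ex := h _ (Or.inr ⟨0, rfl⟩) _ (Or.inl (Or.inr (Or.inl rfl)))
    have ey := h _ (Or.inr ⟨1, rfl⟩) _ (Or.inl (Or.inr (Or.inl rfl)))
    unfold ThrClose at e ex ey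
    simp at e ex ey
    rw [Fin.lt_def, Fin.lt_def]
    simp only [pat_val]
    have := x.isLt
    have := y.isLt
    have := x'.isLt
    have := y'.isLt
    split_ifs <;> omega
  · clear hk
    generalize (2 : ℤ) ^ qdepth ψ = T at hk' ⊢
    rintro p (rfl | rfl | rfl) p' (rfl | rfl | rfl) <;> unfold ThrClose <;> dsimp only <;> omega

/-! ### Ramsey part -/

theorem mono_or_anti {N : ℕ} (σ : Equiv.Perm (Fin N)) : ∀ (r m k : ℕ), m + k = r →
    ∀ s : Finset (Fin N), 2 ^ r ≤ s.card →
    (∃ t ⊆ s, t.card = m ∧ StrictMonoOn σ (t : Set (Fin N))) ∨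
    (∃ t ⊆ s, t.card = k ∧ StrictAntiOn σ (t : Set (Fin N))) := by
  intro r
  induction r with
  | zero =>
    intro m k h s _
    left
    exact ⟨∅, by simp, by simp; omega, fun x hx => by simp at hx⟩
  | succ r ih =>
    intro m k h s hs
    rcases Nat.eq_zero_or_pos m with rfl | hm
    · left
      exact ⟨∅, by simp, by simp, fun x hx => by simp at hx⟩
    rcases Nat.eq_zero_or_pos k with rfl | hk
    · right
      exact ⟨∅, by simp, by simp, fun x hx => by simp at hx⟩
    have hne : s.Nonempty := by
      rw [← Finset.card_pos]
      exact lt_of_lt_of_le (by positivity) hs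
    set a := s.min' hne with ha
    have has : a ∈ s := s.min'_mem hne
    have hmin : ∀ z ∈ s, a ≤ z := fun z hz => s.min'_le z hz
    have hcard := Finset.card_filter_add_card_filter_not (s := s) (fun z => σ z ≤ σ a)
    have h2 : 2 ^ (r + 1) = 2 ^ r + 2 ^ r := by ring
    by_cases hc : 2 ^ r ≤ (s.filter (fun z => ¬ σ z ≤ σ a)).card
    · rcases ih (m - 1) k (by omega) _ hc with ⟨t, ht, htc, hmono⟩ | ⟨t, ht, htc, hanti⟩
      · left
        have hat : a ∉ t := fun h => by simpa using ht h
        refine ⟨insert a t, ?_, ?_, ?_⟩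
        · intro z hz
          rcases Finset.mem_insert.1 hz with rfl | hz
          · exact has
          · exact (Finset.mem_filter.1 (ht hz)).1
        · rw [Finset.card_insert_of_notMem hat]; omega
        · intro x hx y hy hxy
          rw [Finset.coe_insert] at hx hy
          rcases hx with rfl | hx <;> rcases hy with rfl | hy
          · exact absurd hxy (lt_irrefl _)
          · exact not_le.1 (Finset.mem_filter.1 (ht hy)).2
          · exact absurd hxy (not_lt.2 (hmin _ (Finset.mem_filter.1 (ht hx)).1))
          · exact hmono hx hy hxy
      · right
        exact ⟨t, ht.trans (Finset.filter_subset _ _), htc, hanti⟩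
    · have hc' : 2 ^ r ≤ ((s.filter (fun z => σ z ≤ σ a)).erase a).card := by
        rw [Finset.card_erase_of_mem (by simp [has])]
        omega
      rcases ih m (k - 1) (by omega) _ hc' with ⟨t, ht, htc, hmono⟩ | ⟨t, ht, htc, hanti⟩
      · left
        exact ⟨t, ht.trans ((Finset.erase_subset _ _).trans (Finset.filter_subset _ _)), htc, hmono⟩
      · right
        have hat : a ∉ t := fun h => by simpa using ht h
        have hts : ∀ z ∈ t, z ∈ s ∧ σ z < σ a := by
          intro z hz
          have h1 := Finset.mem_erase.1 (ht hz)
          have h2 := Finset.mem_filter.1 h1.2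
          exact ⟨h2.1, lt_of_le_of_ne h2.2 (fun h => h1.1 (σ.injective h))⟩
        refine ⟨insert a t, ?_, ?_, ?_⟩
        · intro z hz
          rcases Finset.mem_insert.1 hz with rfl | hz
          · exact has
          · exact (hts z hz).1
        · rw [Finset.card_insert_of_notMem hat]; omega
        · intro x hx y hy hxy
          rw [Finset.coe_insert] at hx hy
          rcases hx with rfl | hx <;> rcases hy with rfl | hy
          · exact absurd hxy (lt_irrefl _)
          · exact (hts y hy).2
          · exact absurd hxy (not_lt.2 (hmin _ (hts x hx).1))
          · exact hanti hx hy hxy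

theorem isOcc_of {k N : ℕ} (π : Equiv.Perm (Fin k)) (σ : Equiv.Perm (Fin N)) (a : Fin k → Fin N)
    (h1 : StrictMono a) (h2 : ∀ j h, π j < π h → σ (a j) < σ (a h)) : IsOccurrence π σ a := by
  refine ⟨h1, fun j h => ⟨fun hlt => ?_, h2 j h⟩⟩
  rcases lt_trichotomy (π j) (π h) with hh | hh | hh
  · exact hh
  · rw [π.injective hh] at hlt
    exact absurd hlt (lt_irrefl _)
  · exact absurd hlt (lt_asymm (h2 _ _ hh))

theorem occ_rev {k N : ℕ} (σ : Equiv.Perm (Fin N)) (t : Finset (Fin N)) (ht : t.card = k)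
    (h : StrictAntiOn σ (t : Set (Fin N))) :
    ∃ a, IsOccurrence (Fin.revPerm : Equiv.Perm (Fin k)) σ a := by
  refine ⟨t.orderEmbOfFin ht, isOcc_of _ _ _ (t.orderEmbOfFin ht).strictMono ?_⟩
  intro i j hij
  rw [Fin.revPerm_apply, Fin.revPerm_apply, Fin.rev_lt_rev] at hij
  exact h (t.orderEmbOfFin_mem ht j) (t.orderEmbOfFin_mem ht i) ((t.orderEmbOfFin ht).strictMono hij)

/-- Elements of type A (`b = true`): to the left and above; type B: to the right and below. -/
def invSet {N : ℕ} (σ : Equiv.Perm (Fin N)) (b : Bool) (a : Fin N) : Finset (Fin N) :=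
  Finset.univ.filter (fun z => if b then z < a ∧ σ a < σ z else a < z ∧ σ z < σ a)

theorem occ_pat {m n N : ℕ} (σ : Equiv.Perm (Fin N)) (a : Fin N) (t u : Finset (Fin N))
    (ht : t.card = m) (hu : u.card = n) (htA : t ⊆ invSet σ true a) (huB : u ⊆ invSet σ false a)
    (h : StrictMonoOn σ (t : Set (Fin N))) (h' : StrictMonoOn σ (u : Set (Fin N))) :
    ∃ a, IsOccurrence (pat321 m n) σ a := by
  have hA : ∀ i, t.orderEmbOfFin ht i < a ∧ σ a < σ (t.orderEmbOfFin ht i) := by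
    intro i
    have := htA (t.orderEmbOfFin_mem ht i)
    simpa [invSet] using this
  have hB : ∀ i, a < u.orderEmbOfFin hu i ∧ σ (u.orderEmbOfFin hu i) < σ a := by
    intro i
    have := huB (u.orderEmbOfFin_mem hu i)
    simpa [invSet] using this
  have hAm : ∀ i j, i < j → t.orderEmbOfFin ht i < t.orderEmbOfFin ht j := 
    fun i j hij => (t.orderEmbOfFin ht).strictMono hij
  have hBm : ∀ i j, i < j → u.orderEmbOfFin hu i < u.orderEmbOfFin hu j := 
    fun i j hij => (u.orderEmbOfFin hu).strictMono hij
  have hAs : ∀ i j, i < j → σ (t.orderEmbOfFin ht i) < σ (t.orderEmbOfFin ht j) := 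
    fun i j hij => h (t.orderEmbOfFin_mem ht i) (t.orderEmbOfFin_mem ht j) (hAm i j hij)
  have hBs : ∀ i j, i < j → σ (u.orderEmbOfFin hu i) < σ (u.orderEmbOfFin hu j) := 
    fun i j hij => h' (u.orderEmbOfFin_mem hu i) (u.orderEmbOfFin_mem hu j) (hBm i j hij)
  refine ⟨fun p => if hp : (p : ℕ) < m then t.orderEmbOfFin ht ⟨p, hp⟩
    else if hp' : (p : ℕ) = m then a else u.orderEmbOfFin hu ⟨p - m - 1, by omega⟩,
    isOcc_of _ _ _ ?_ ?_⟩
  · intro i j hij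
    rw [Fin.lt_def] at hij
    dsimp only
    split_ifs
    · exact hAm _ _ hij
    · exact (hA _).1
    · exact (hA _).1.trans (hB _).1
    · omega
    · omega
    · exact (hB _).1
    · omega
    · omega
    · exact hBm _ _ (by rw [Fin.lt_def]; dsimp only; omega)
  · intro i j hij
    rw [Fin.lt_def, pat_val, pat_val] at hij
    have := i.isLt
    have := j.isLt
    split_ifs at hij ⊢
    · exact hAs _ _ (by rw [Fin.lt_def]; dsimp only; omega)
    · omega
    · omega
    · exact (hA _).2
    · omega
    · omega
    · exact (hB _).2.trans (hA _).2
    · exact (hB _).2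
    · exact hBs _ _ (by rw [Fin.lt_def]; dsimp only; omega)

theorem fixed_iff_card {N : ℕ} (σ : Equiv.Perm (Fin N)) (a : Fin N) :
    σ a = a ↔ (invSet σ true a).card = (invSet σ false a).card := by
  have e1 : (Finset.univ.filter (fun z => z < a)).card = (a : ℕ) := by
    rw [← Fin.card_Iio a]; congr 1; ext; simp
  have e2 : (Finset.univ.filter (fun z => σ z < σ a)).card = ((σ a : Fin N) : ℕ) := by
    rw [← Fin.card_Iio (σ a)]
    apply Finset.card_bij (fun z _ => σ z)
    · intro z hz; simpa using hz
    · intro x _ y _ h; exact σ.injective h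
    · intro y hy; exact ⟨σ.symm y, by simpa using hy, by simp⟩
  have f1 := Finset.card_filter_add_card_filter_not (s := Finset.univ.filter (fun z => z < a))
    (fun z => σ z < σ a)
  have f2 := Finset.card_filter_add_card_filter_not
    (s := Finset.univ.filter (fun z => σ z < σ a)) (fun z => z < a)
  have g0 : (Finset.univ.filter (fun z => z < a)).filter (fun z => σ z < σ a) =
    (Finset.univ.filter (fun z => σ z < σ a)).filter (fun z => z < a) := by
    ext z; simp [and_comm]
  have g1 : (Finset.univ.filter (fun z => z < a)).filter (fun z => ¬ σ z < σ a) =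
    invSet σ true a := by
    ext z
    simp only [invSet, Finset.mem_filter, Finset.mem_univ, true_and, if_true, not_lt]
    refine and_congr_right fun h => ⟨fun h2 => lt_of_le_of_ne h2 ?_, le_of_lt⟩
    intro h3
    exact h.ne (σ.injective h3).symm
  have g2 : (Finset.univ.filter (fun z => σ z < σ a)).filter (fun z => ¬ z < a) =
    invSet σ false a := by
    ext z
    simp only [invSet, Finset.mem_filter, Finset.mem_univ, true_and, not_lt, and_comm]
    refine and_congr_left fun h => ⟨fun h2 => lt_of_le_of_ne h2 ?_, le_of_lt⟩
    rintro rfl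
    exact lt_irrefl _ h
  rw [g0, g1, e1] at f1
  rw [g2, e2] at f2
  rw [Fin.ext_iff]
  omega

/-! ### Formulas -/

/-- Atomic formula for positions. -/
def fP {α : Type} (x y : α) : L2.Formula α :=
  FirstOrder.Language.Relations.formula₂ (L := L2) TwoOrderRel.ltP (.var x) (.var y)

/-- Atomic formula for values. -/
def fV {α : Type} (x y : α) : L2.Formula α :=
  FirstOrder.Language.Relations.formula₂ (L := L2) TwoOrderRel.ltV (.var x) (.var y)

theorem real_fP {N : ℕ} {α : Type} (σ : Equiv.Perm (Fin N)) (x y : α) (v : α → Fin N) :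
    (letI := permStruc2 σ; (fP x y).Realize v) ↔ v x < v y := by
  let _ := permStruc2 σ
  exact (FirstOrder.Language.Formula.realize_rel₂ (L := L2) (R := TwoOrderRel.ltP)
    (t₁ := .var x) (t₂ := .var y) (v := v)).trans Iff.rfl

theorem real_fV {N : ℕ} {α : Type} (σ : Equiv.Perm (Fin N)) (x y : α) (v : α → Fin N) :
    (letI := permStruc2 σ; (fV x y).Realize v) ↔ σ (v x) < σ (v y) := by
  let _ := permStruc2 σ
  exact (FirstOrder.Language.Formula.realize_rel₂ (L := L2) (R := TwoOrderRel.ltV)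
    (t₁ := .var x) (t₂ := .var y) (v := v)).trans Iff.rfl

/-- Being in the set `invSet`. -/
def fIn {α : Type} (b : Bool) (z a : α) : L2.Formula α :=
  if b then fP z a ⊓ fV a z else fP a z ⊓ fV z a

/-- At least `j` elements in `invSet`. -/
noncomputable def fGe (b : Bool) (j : ℕ) : L2.Formula (Fin 1) :=
  FirstOrder.Language.Formula.iExs (Fin j)
    ((FirstOrder.Language.Formula.iInf fun p : Fin j =>
        (fIn b (Sum.inr p) (Sum.inl 0) : L2.Formula (Fin 1 ⊕ Fin j))) ⊓
      (FirstOrder.Language.Formula.iInf fun p : {p : Fin j × Fin j // p.1 < p.2} =>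
        (fP (Sum.inr p.1.1) (Sum.inr p.1.2) : L2.Formula (Fin 1 ⊕ Fin j))))

theorem real_fIn {N : ℕ} {α : Type} (σ : Equiv.Perm (Fin N)) (b : Bool) (x y : α) (v : α → Fin N) :
    (letI := permStruc2 σ; (fIn b x y).Realize v) ↔ v x ∈ invSet σ b (v y) := by
  let _ := permStruc2 σ
  cases b
  · simp only [fIn, invSet, Bool.false_eq_true, if_false, FirstOrder.Language.Formula.realize_inf,
      Finset.mem_filter, Finset.mem_univ, true_and]
    exact and_congr (real_fP σ _ _ v) (real_fV σ _ _ v)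
  · simp only [fIn, invSet, if_true, FirstOrder.Language.Formula.realize_inf,
      Finset.mem_filter, Finset.mem_univ, true_and]
    exact and_congr (real_fP σ _ _ v) (real_fV σ _ _ v)

theorem real_fGe {N : ℕ} (σ : Equiv.Perm (Fin N)) (b : Bool) (j : ℕ) (v : Fin 1 → Fin N) :
    (letI := permStruc2 σ; (fGe b j).Realize v) ↔ j ≤ (invSet σ b (v 0)).card := by
  let _ := permStruc2 σ
  unfold fGe
  rw [FirstOrder.Language.Formula.realize_iExs]
  simp only [FirstOrder.Language.Formula.realize_inf, FirstOrder.Language.Formula.realize_iInf]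
  constructor
  · rintro ⟨f, h1, h2⟩
    have hf : StrictMono f := fun p q hpq => (real_fP σ _ _ _).1 (h2 ⟨(p, q), hpq⟩)
    have h3 : ∀ p, f p ∈ invSet σ b (v 0) := fun p => (real_fIn σ b _ _ _).1 (h1 p)
    have := Finset.card_le_card_of_injOn (s := Finset.univ) f (fun p _ => h3 p)
      (hf.injective.injOn)
    simpa using this
  · intro h
    refine ⟨Finset.orderEmbOfCardLe _ h, fun p => (real_fIn σ b _ _ _).2 ?_,
      fun p => (real_fP σ _ _ _).2 ?_⟩
    · exact Finset.orderEmbOfCardLe_mem _ h p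
    · exact (Finset.orderEmbOfCardLe _ h).strictMono p.2

/-- The fixed point formula. -/
noncomputable def fFix (K : ℕ) : L2.Formula (Fin 1) :=
  FirstOrder.Language.Formula.iSup fun j : Fin K =>
    ((fGe true j ⊓ (fGe true (j + 1)).not) ⊓ (fGe false j ⊓ (fGe false (j + 1)).not))

theorem real_fFix {N : ℕ} (σ : Equiv.Perm (Fin N)) (K : ℕ) (v : Fin 1 → Fin N) :
    Real2 σ (fFix K) v ↔
      (invSet σ true (v 0)).card = (invSet σ false (v 0)).card ∧
        (invSet σ true (v 0)).card < K := by
  let _ := permStruc2 σ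
  have key : ∀ b j, (fGe b j).Realize v ↔ j ≤ (invSet σ b (v 0)).card := fun b j =>
    real_fGe σ b j v
  unfold Real2 fFix
  simp only [FirstOrder.Language.Formula.realize_iSup, FirstOrder.Language.Formula.realize_inf,
    FirstOrder.Language.Formula.realize_not]
  constructor
  · rintro ⟨j, ⟨h1, h2⟩, h3, h4⟩
    have h1 := (key _ _).1 h1
    have h3 := (key _ _).1 h3
    have h2 : ¬ ((j : ℕ) + 1 ≤ (invSet σ true (v 0)).card) := fun h => h2 ((key _ _).2 h)
    have h4 : ¬ ((j : ℕ) + 1 ≤ (invSet σ false (v 0)).card) := fun h => h4 ((key _ _).2 h)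
    have := j.isLt
    omega
  · rintro ⟨h1, h2⟩
    exact ⟨⟨_, h2⟩, ⟨(key _ _).2 le_rfl, fun h => by have := (key _ _).1 h; dsimp only at this; omega⟩,
      (key _ _).2 h1.le, fun h => by have := (key _ _).1 h; dsimp only at this; omega⟩

theorem step32 (C : Set Perms) (hC : PermClass C)
    (h : ∃ k m n : ℕ, 0 < k ∧ 0 < m ∧ 0 < n ∧
          (⟨k, (Fin.revPerm : Equiv.Perm (Fin k))⟩ : Perms) ∉ C ∧
          (⟨m + n + 1, pat321 m n⟩ : Perms) ∉ C) :
    ∃ φ : L2.Formula (Fin 1), ∀ (n : ℕ) (σ : Equiv.Perm (Fin n)),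
          (⟨n, σ⟩ : Perms) ∈ C → ∀ a : Fin n, (Real2 σ φ ![a] ↔ σ a = a) := by
  obtain ⟨k, m, n, -, -, -, hk, hp⟩ := h
  refine ⟨fFix (2 ^ (m + n + k)), fun N σ hσ a => ?_⟩
  rw [real_fFix, fixed_iff_card]
  refine ⟨fun h => h.1, fun h => ⟨h, ?_⟩⟩
  by_contra hlt
  change ¬ (invSet σ true a).card < _ at hlt
  change (invSet σ true a).card = (invSet σ false a).card at h
  have p1 : 2 ^ (m + k) ≤ 2 ^ (m + n + k) := Nat.pow_le_pow_right (by norm_num) (by omega)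
  have p2 : 2 ^ (n + k) ≤ 2 ^ (m + n + k) := Nat.pow_le_pow_right (by norm_num) (by omega)
  have hnr : ∀ t : Finset (Fin N), t.card = k → ¬ StrictAntiOn σ (t : Set (Fin N)) :=
    fun t ht hanti => hk (hC _ hσ _ (occ_rev σ t ht hanti))
  rcases mono_or_anti σ _ m k rfl (invSet σ true a) (by omega) with ⟨t, ht, htc, hm⟩ | ⟨t, _, h1, h2⟩
  · rcases mono_or_anti σ _ n k rfl (invSet σ false a) (by omega) with
      ⟨u, hu, huc, hm'⟩ | ⟨t, _, h1, h2⟩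
    · exact hp (hC _ hσ _ (occ_pat σ a t u htc huc ht hu hm hm'))
    · exact hnr t h1 h2
  · exact hnr t h1 h2

theorem step21 (C : Set Perms)
    (h : ∃ φ : L2.Formula (Fin 1), ∀ (n : ℕ) (σ : Equiv.Perm (Fin n)),
          (⟨n, σ⟩ : Perms) ∈ C → ∀ a : Fin n, (Real2 σ φ ![a] ↔ σ a = a)) :
    ∃ ψ : L2.Sentence, ∀ (n : ℕ) (σ : Equiv.Perm (Fin n)), (⟨n, σ⟩ : Perms) ∈ C →
          (Sat2 σ ψ ↔ ∃ i : Fin n, σ i = i) := by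
  obtain ⟨φ, hφ⟩ := h
  refine ⟨FirstOrder.Language.Formula.iExs (Fin 1)
    (φ.relabel (Sum.inr : Fin 1 → Empty ⊕ Fin 1) : L2.Formula (Empty ⊕ Fin 1)), fun n σ hσ => ?_⟩
  let _ := permStruc2 σ
  unfold Sat2 FirstOrder.Language.Sentence.Realize
  rw [FirstOrder.Language.Formula.realize_iExs]
  simp only [FirstOrder.Language.Formula.realize_relabel, Sum.elim_comp_inr]
  constructor
  · rintro ⟨i, hi⟩
    refine ⟨i 0, (hφ n σ hσ (i 0)).1 ?_⟩
    have : ![i 0] = i := by ext j; fin_cases j; rfl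
    rw [this]
    exact hi
  · rintro ⟨i, hi⟩
    exact ⟨![i], (hφ n σ hσ i).2 hi⟩

theorem step13 (C : Set Perms)
    (h : ∃ ψ : L2.Sentence, ∀ (n : ℕ) (σ : Equiv.Perm (Fin n)), (⟨n, σ⟩ : Perms) ∈ C →
          (Sat2 σ ψ ↔ ∃ i : Fin n, σ i = i)) :
    ∃ k m n : ℕ, 0 < k ∧ 0 < m ∧ 0 < n ∧
          (⟨k, (Fin.revPerm : Equiv.Perm (Fin k))⟩ : Perms) ∉ C ∧
          (⟨m + n + 1, pat321 m n⟩ : Perms) ∉ C := by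
  obtain ⟨ψ, hψ⟩ := h
  have h2 : 0 < 2 ^ qdepth ψ := by positivity
  have hk : ∃ k, 0 < k ∧ (⟨k, (Fin.revPerm : Equiv.Perm (Fin k))⟩ : Perms) ∉ C := by
    by_contra hall
    push Not at hall
    have e := rev_equiv ψ (2 ^ qdepth ψ) le_rfl
    rw [hψ _ _ (hall _ h2), hψ _ _ (hall _ (by omega)), rev_fixed, rev_fixed] at e
    omega
  have hp : ∃ m n, 0 < m ∧ 0 < n ∧ (⟨m + n + 1, pat321 m n⟩ : Perms) ∉ C := by
    by_contra hall
    push Not at hall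
    have e := pat_equiv ψ (2 ^ qdepth ψ) le_rfl
    rw [hψ _ _ (hall _ _ h2 h2), hψ _ _ (hall _ _ h2 (by omega)), pat_fixed, pat_fixed] at e
    omega
  obtain ⟨k, hk0, hk⟩ := hk
  obtain ⟨m, n, hm, hn, hp⟩ := hp
  exact ⟨k, m, n, hk0, hm, hn, hk, hp⟩

theorem fixed_point_expressible_in_class_iff (C : Set Perms) (hC : PermClass C) :
    ((∃ ψ : L2.Sentence, ∀ (n : ℕ) (σ : Equiv.Perm (Fin n)), (⟨n, σ⟩ : Perms) ∈ C →
          (Sat2 σ ψ ↔ ∃ i : Fin n, σ i = i)) ↔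
        (∃ φ : L2.Formula (Fin 1), ∀ (n : ℕ) (σ : Equiv.Perm (Fin n)),
          (⟨n, σ⟩ : Perms) ∈ C → ∀ a : Fin n, (Real2 σ φ ![a] ↔ σ a = a))) ∧
      ((∃ φ : L2.Formula (Fin 1), ∀ (n : ℕ) (σ : Equiv.Perm (Fin n)),
          (⟨n, σ⟩ : Perms) ∈ C → ∀ a : Fin n, (Real2 σ φ ![a] ↔ σ a = a)) ↔
        (∃ k m n : ℕ, 0 < k ∧ 0 < m ∧ 0 < n ∧
          (⟨k, (Fin.revPerm : Equiv.Perm (Fin k))⟩ : Perms) ∉ C ∧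
          (⟨m + n + 1, pat321 m n⟩ : Perms) ∉ C)) := by
  exact ⟨⟨fun h => step32 C hC (step13 C h), step21 C⟩,
    ⟨fun h => step13 C (step21 C h), step32 C hC⟩⟩
end

section
/- Let C be a permutation class. There exists an L2-formula φ(x,y) with two free variables such that for every σ ∈ C and all elements a, b: φ(a,b) holds in M_σ if and only if (a,b) is a transposition of σ (i.e., a ≠ b, σ(a) = b and σ(b) = a), if and only if there exist integers k ≥ 2, m ≥ 1 and n ≥ 1 such that neither δ_k nor inc_m ⊖ inc_n belongs to C. -/
open FirstOrder

def incOminusIncFun (m n : ℕ) (p : Fin (m + n)) : Fin (m + n) :=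
  if _ : (p : ℕ) < m then ⟨n + p, by omega⟩
  else ⟨(p : ℕ) - m, by have := p.isLt; omega⟩

theorem incOminusIncFun_injective (m n : ℕ) :
    Function.Injective (incOminusIncFun m n) := by
  intro p q h
  have hp := p.isLt
  have hq := q.isLt
  unfold incOminusIncFun at h
  apply Fin.ext
  split_ifs at h <;> simp only [Fin.mk.injEq] at h <;> omega

/-- The permutation `inc_m ⊖ inc_n` of size `m + n`: with positions and values
`0`-indexed, positions `0,…,m-1` are sent to `n,…,n+m-1`, and positions `m,…,m+n-1`
to `0,…,n-1`. -/
noncomputable def incOminusInc (m n : ℕ) : Equiv.Perm (Fin (m + n)) :=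
  Equiv.ofBijective _ (Finite.injective_iff_bijective.mp (incOminusIncFun_injective m n))

/-- clamped difference -/
def clampT (t d : ℤ) : ℤ := max (-t) (min t d)

def EqT {ι : Type} (t : ℤ) (u u' : ι → ℤ) : Prop :=
  ∀ i j, clampT t (u i - u j) = clampT t (u' i - u' j)

theorem EqT.mono {ι : Type} {t s : ℤ} {u u' : ι → ℤ} (h : EqT t u u') (hs : s ≤ t) (h0 : 0 ≤ s) :
    EqT s u u' := by
  intro i j
  have := h i j
  unfold clampT at *
  omega

theorem EqT.symm {ι : Type} {t : ℤ} {u u' : ι → ℤ} (h : EqT t u u') : EqT t u' u :=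
  fun i j => (h i j).symm

theorem EqT.extend {ι : Type} [Finite ι] {t : ℤ} (ht : 1 ≤ t) {u u' : ι → ℤ}
    (h : EqT (2 * t) u u') (x : ℤ) (hlo : ∃ i, u i ≤ x) (hhi : ∃ i, x ≤ u i) :
    ∃ y, ∀ i, clampT t (u i - x) = clampT t (u' i - y) := by
  classical
  by_cases hA : ∃ i, |x - u i| ≤ t
  · obtain ⟨i, hi⟩ := hA
    refine ⟨u' i + (x - u i), fun l => ?_⟩
    have := h l i
    rw [abs_le] at hi
    unfold clampT at *
    omega
  · push Not at hA
    have e1 : ∃ i, u i ≤ x ∧ ∀ l, u l ≤ x → u l ≤ u i := by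
      obtain ⟨i, hi, hm⟩ := Set.exists_max_image {i | u i ≤ x} u (Set.toFinite _) hlo
      exact ⟨i, hi, fun l hl => hm l hl⟩
    have e2 : ∃ i, x ≤ u i ∧ ∀ l, x ≤ u l → u i ≤ u l := by
      obtain ⟨i, hi, hm⟩ := Set.exists_min_image {i | x ≤ u i} u (Set.toFinite _) hhi
      exact ⟨i, hi, fun l hl => hm l hl⟩
    obtain ⟨i, hi, hi'⟩ := e1
    obtain ⟨j, hj, hj'⟩ := e2
    refine ⟨u' i + t, fun l => ?_⟩
    have a1 := hA i
    have a2 := hA j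
    have a3 := hA l
    rw [lt_abs] at a1 a2 a3
    have h1 := h i j
    have h2 := h l i
    have h3 := h l j
    have h4 := hi' l
    have h5 := hj' l
    unfold clampT at *
    rcases le_total (u l) x with hl | hl
    · have := h4 hl
      omega
    · have := h5 hl
      omega

/-- integer valuation with markers -/
def valT {α : Type} {n N : ℕ} (c : ℤ) (v : α → Fin N) (xs : Fin n → Fin N) :
    Fin 3 ⊕ (α ⊕ Fin n) → ℤ :=
  Sum.elim ![-1, (N : ℤ), c] (fun i => ((Sum.elim v xs i : Fin N) : ℕ))

theorem EqT_snoc {α : Type} [Finite α] {n N : ℕ} {c : ℤ} {t : ℤ} (ht : 1 ≤ t)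
    {v v' : α → Fin N} {xs xs' : Fin n → Fin N}
    (h : EqT (2 * t) (valT c v xs) (valT c v' xs')) (x : Fin N) :
    ∃ y : Fin N, EqT t (valT c v (Fin.snoc xs x : Fin (n+1) → Fin N))
      (valT c v' (Fin.snoc xs' y : Fin (n+1) → Fin N)) := by
  obtain ⟨y, hy⟩ := h.extend ht (x : ℕ) ⟨Sum.inl 0, by simp [valT]⟩
    ⟨Sum.inl 1, by simp [valT]⟩
  have y0 := hy (Sum.inl 0)
  have y1 := hy (Sum.inl 1)
  simp only [valT, Sum.elim_inl, Matrix.cons_val_zero, Matrix.cons_val_one, clampT] at y0 y1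
  have hx := x.isLt
  have hy0 : 0 ≤ y ∧ y < N := by omega
  obtain ⟨z, rfl⟩ := Int.eq_ofNat_of_zero_le hy0.1
  refine ⟨⟨z, by omega⟩, ?_⟩
  have ht0 : EqT t (valT c v xs) (valT c v' xs') := h.mono (by omega) (by omega)
  have key : ∀ (P : Fin 3 ⊕ (α ⊕ Fin (n+1)) → Prop),
      (P (Sum.inr (Sum.inr (Fin.last n)))) →
      (∀ i : Fin 3 ⊕ (α ⊕ Fin n), P (Sum.map id (Sum.map id Fin.castSucc) i)) → ∀ i, P i := by
    intro P h1 h2 i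
    rcases i with i | i | i
    · exact h2 (Sum.inl i)
    · exact h2 (Sum.inr (Sum.inl i))
    · induction i using Fin.lastCases with
      | last => exact h1
      | cast i => exact h2 (Sum.inr (Sum.inr i))
  have old : ∀ (w : α → Fin N) (ys : Fin n → Fin N) (q : Fin N) (i : Fin 3 ⊕ (α ⊕ Fin n)),
      valT c w (Fin.snoc ys q : Fin (n+1) → Fin N) (Sum.map id (Sum.map id Fin.castSucc) i)
        = valT c w ys i := by
    intro w ys q i
    rcases i with i | i | i <;> simp [valT]
  have new : ∀ (w : α → Fin N) (ys : Fin n → Fin N) (q : Fin N),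
      valT c w (Fin.snoc ys q : Fin (n+1) → Fin N) (Sum.inr (Sum.inr (Fin.last n)))
        = (q : ℕ) := by
    intro w ys q
    simp [valT]
  intro i j
  revert i
  refine key _ ?_ ?_
  · revert j
    refine key _ ?_ ?_
    · simp
    · intro j
      rw [new, old, new, old]
      have := hy j
      unfold clampT at *
      dsimp only
      omega
  · intro i
    revert j
    refine key _ ?_ ?_
    · rw [new, old, new, old]
      exact hy i
    · intro j
      rw [old, old, old, old]
      exact ht0 i j

/-- the value order is determined by the position order and a cut point -/
def CutDet {N : ℕ} (σ : Equiv.Perm (Fin N)) (c : ℤ) : Prop :=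
  ∀ x y x' y' : Fin N, (((x : ℕ) : ℤ) < c ↔ ((x' : ℕ) : ℤ) < c) →
    (((y : ℕ) : ℤ) < c ↔ ((y' : ℕ) : ℤ) < c) → (x < y ↔ x' < y') → (y < x ↔ y' < x') →
    (σ x < σ y ↔ σ x' < σ y')

theorem term_var {β : Type} (s : L2.Term β) : ∃ i, s = FirstOrder.Language.Term.var i := by
  cases s with
  | var i => exact ⟨i, rfl⟩
  | func f _ => exact Empty.elim f

theorem EqT.lt {α : Type} {n N : ℕ} {c : ℤ} {t : ℤ} (ht : 1 ≤ t)
    {v v' : α → Fin N} {xs xs' : Fin n → Fin N}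
    (h : EqT t (valT c v xs) (valT c v' xs')) (i j : α ⊕ Fin n) :
    (Sum.elim v xs i < Sum.elim v xs j ↔ Sum.elim v' xs' i < Sum.elim v' xs' j) := by
  have := h (Sum.inr i) (Sum.inr j)
  simp only [valT, clampT, Sum.elim_inr] at this
  rw [Fin.lt_def, Fin.lt_def]
  omega

theorem EqT.cut {α : Type} {n N : ℕ} {c : ℤ} {t : ℤ} (ht : 1 ≤ t)
    {v v' : α → Fin N} {xs xs' : Fin n → Fin N}
    (h : EqT t (valT c v xs) (valT c v' xs')) (i : α ⊕ Fin n) :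
    (((Sum.elim v xs i : Fin N) : ℕ) : ℤ) < c ↔ (((Sum.elim v' xs' i : Fin N) : ℕ) : ℤ) < c := by
  have := h (Sum.inr i) (Sum.inl 2)
  have e : (![-1, (N : ℤ), c] : Fin 3 → ℤ) 2 = c := rfl
  simp only [valT, clampT, Sum.elim_inr, Sum.elim_inl, e] at this
  omega

theorem ef_main {α : Type} [Finite α] {n : ℕ} (φ : L2.BoundedFormula α n) :
    ∃ t : ℤ, 1 ≤ t ∧ ∀ (N : ℕ) (σ : Equiv.Perm (Fin N)) (c : ℤ), CutDet σ c →
      ∀ (v v' : α → Fin N) (xs xs' : Fin n → Fin N),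
        EqT t (valT c v xs) (valT c v' xs') →
        (@FirstOrder.Language.BoundedFormula.Realize L2 (Fin N) (permStruc2 σ) α n φ v xs ↔
         @FirstOrder.Language.BoundedFormula.Realize L2 (Fin N) (permStruc2 σ) α n φ v' xs') := by
  induction φ with
  | falsum => exact ⟨1, le_refl _, fun _ _ _ _ _ _ _ _ _ => Iff.rfl⟩
  | equal s₁ s₂ =>
    refine ⟨1, le_refl _, fun N σ c hσ v v' xs xs' h => ?_⟩
    obtain ⟨i, rfl⟩ := term_var s₁
    obtain ⟨j, rfl⟩ := term_var s₂
    have h1 := h.lt (le_refl _) i j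
    have h2 := h.lt (le_refl _) j i
    change Sum.elim v xs i = Sum.elim v xs j ↔ Sum.elim v' xs' i = Sum.elim v' xs' j
    constructor <;> intro he
    · exact le_antisymm (not_lt.1 fun hh => absurd (h2.2 hh) (by rw [he]; exact lt_irrefl _))
        (not_lt.1 fun hh => absurd (h1.2 hh) (by rw [he]; exact lt_irrefl _))
    · exact le_antisymm (not_lt.1 fun hh => absurd (h2.1 hh) (by rw [he]; exact lt_irrefl _))
        (not_lt.1 fun hh => absurd (h1.1 hh) (by rw [he]; exact lt_irrefl _))
  | rel R ts =>
    refine ⟨1, le_refl _, fun N σ c hσ v v' xs xs' h => ?_⟩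
    cases R with
    | ltP =>
      obtain ⟨i, hi⟩ := term_var (ts 0)
      obtain ⟨j, hj⟩ := term_var (ts 1)
      have h1 := h.lt (le_refl _) i j
      change @FirstOrder.Language.Term.realize L2 (Fin N) (permStruc2 σ) _ (Sum.elim v xs) (ts 0)
        < @FirstOrder.Language.Term.realize L2 (Fin N) (permStruc2 σ) _ (Sum.elim v xs) (ts 1) ↔
        @FirstOrder.Language.Term.realize L2 (Fin N) (permStruc2 σ) _ (Sum.elim v' xs') (ts 0)
        < @FirstOrder.Language.Term.realize L2 (Fin N) (permStruc2 σ) _ (Sum.elim v' xs') (ts 1)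
      rw [hi, hj]
      exact h1
    | ltV =>
      obtain ⟨i, hi⟩ := term_var (ts 0)
      obtain ⟨j, hj⟩ := term_var (ts 1)
      have h1 := hσ _ _ _ _ (h.cut (le_refl _) i) (h.cut (le_refl _) j)
        (h.lt (le_refl _) i j) (h.lt (le_refl _) j i)
      change σ (@FirstOrder.Language.Term.realize L2 (Fin N) (permStruc2 σ) _ (Sum.elim v xs) (ts 0))
        < σ (@FirstOrder.Language.Term.realize L2 (Fin N) (permStruc2 σ) _ (Sum.elim v xs) (ts 1)) ↔
        σ (@FirstOrder.Language.Term.realize L2 (Fin N) (permStruc2 σ) _ (Sum.elim v' xs') (ts 0))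
        < σ (@FirstOrder.Language.Term.realize L2 (Fin N) (permStruc2 σ) _ (Sum.elim v' xs') (ts 1))
      rw [hi, hj]
      exact h1
  | imp f g hf hg =>
    obtain ⟨t₁, ht₁, h₁⟩ := hf
    obtain ⟨t₂, ht₂, h₂⟩ := hg
    refine ⟨max t₁ t₂, by omega, fun N σ c hσ v v' xs xs' h => ?_⟩
    exact imp_congr (h₁ N σ c hσ v v' xs xs' (h.mono (by omega) (by omega)))
      (h₂ N σ c hσ v v' xs xs' (h.mono (by omega) (by omega)))
  | all f hf =>
    obtain ⟨t, ht, h₁⟩ := hf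
    refine ⟨2 * t, by omega, fun N σ c hσ v v' xs xs' h => ?_⟩
    constructor
    · intro hx y
      obtain ⟨x, hxy⟩ := EqT_snoc ht h.symm y
      exact (h₁ N σ c hσ _ _ _ _ hxy).2 (hx x)
    · intro hx y
      obtain ⟨x, hxy⟩ := EqT_snoc ht h y
      exact (h₁ N σ c hσ _ _ _ _ hxy).2 (hx x)

theorem cutDet_rev (k : ℕ) : CutDet (Fin.revPerm : Equiv.Perm (Fin k)) (-1) := by
  intro x y x' y' _ _ _ h
  simpa using h

theorem incOminusInc_val (m n : ℕ) (p : Fin (m + n)) :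
    ((incOminusInc m n p : Fin (m + n)) : ℕ) = if (p : ℕ) < m then n + p else p - m := by
  change ((incOminusIncFun m n p : Fin (m + n)) : ℕ) = _
  unfold incOminusIncFun
  split_ifs <;> rfl

theorem cutDet_inc (m n : ℕ) : CutDet (incOminusInc m n) m := by
  intro x y x' y' h1 h2 h3 h4
  simp only [Fin.lt_def, incOminusInc_val] at *
  split_ifs <;> omega

theorem eqT_far {N : ℕ} {c t : ℤ} {a b b' : Fin N} (xs xs' : Fin 0 → Fin N)
    (h1 : t ≤ (b : ℕ) - (a : ℕ)) (h2 : t ≤ (b' : ℕ) - (a : ℕ)) (h0 : 0 ≤ t)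
    (h3 : t ≤ N - (b : ℕ)) (h4 : t ≤ N - (b' : ℕ))
    (h5 : t ≤ (b : ℕ) - c) (h6 : t ≤ (b' : ℕ) - c) :
    EqT t (valT c ![a, b] xs) (valT c ![a, b'] xs') := by
  have e : (![-1, (N : ℤ), c] : Fin 3 → ℤ) 2 = c := rfl
  have key : ∀ (P : Fin 3 ⊕ (Fin 2 ⊕ Fin 0) → Prop), P (Sum.inl 0) → P (Sum.inl 1) →
      P (Sum.inl 2) → P (Sum.inr (Sum.inl 0)) → P (Sum.inr (Sum.inl 1)) → ∀ i, P i := by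
    intro P p0 p1 p2 p3 p4 i
    rcases i with i | i | i
    · fin_cases i <;> assumption
    · fin_cases i <;> assumption
    · exact i.elim0
  intro i j
  revert i
  apply key <;> revert j <;> apply key <;>
    simp only [valT, clampT, Sum.elim_inl, Sum.elim_inr, e, Matrix.cons_val_zero,
      Matrix.cons_val_one] <;> omega

theorem forward_dir (C : Set Perms) (φ : L2.Formula (Fin 2))
    (hφ : ∀ (n : ℕ) (σ : Equiv.Perm (Fin n)),
        (⟨n, σ⟩ : Perms) ∈ C → ∀ a b : Fin n,
          (Real2 σ φ ![a, b] ↔ (a ≠ b ∧ σ a = b ∧ σ b = a))) :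
    (∃ k m n : ℕ, 2 ≤ k ∧ 1 ≤ m ∧ 1 ≤ n ∧
        (⟨k, (Fin.revPerm : Equiv.Perm (Fin k))⟩ : Perms) ∉ C ∧
        (⟨m + n, incOminusInc m n⟩ : Perms) ∉ C) := by
  obtain ⟨t, ht, h⟩ := ef_main φ
  obtain ⟨s, rfl⟩ := Int.eq_ofNat_of_zero_le (by omega : 0 ≤ t)
  have hs : 1 ≤ s := by omega
  refine ⟨6 * s, 4 * s, 4 * s, by omega, by omega, by omega, fun hin => ?_, fun hin => ?_⟩
  · have e1 := hφ _ _ hin ⟨2 * s, by omega⟩ ⟨4 * s - 1, by omega⟩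
    have e2 := hφ _ _ hin ⟨2 * s, by omega⟩ ⟨4 * s, by omega⟩
    have := h _ _ _ (cutDet_rev (6 * s)) ![⟨2 * s, by omega⟩, ⟨4 * s - 1, by omega⟩]
      ![⟨2 * s, by omega⟩, ⟨4 * s, by omega⟩] default default (by
        apply eqT_far <;> (try dsimp only) <;> omega)
    have this' := e1.symm.trans (this.trans e2)
    simp only [ne_eq, Fin.ext_iff, Fin.revPerm_apply, Fin.val_rev] at this'
    omega
  · have e1 := hφ _ _ hin ⟨s, by omega⟩ ⟨5 * s, by omega⟩
    have e2 := hφ _ _ hin ⟨s, by omega⟩ ⟨5 * s + 1, by omega⟩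
    have := h _ _ _ (cutDet_inc (4 * s) (4 * s)) ![⟨s, by omega⟩, ⟨5 * s, by omega⟩]
      ![⟨s, by omega⟩, ⟨5 * s + 1, by omega⟩] default default (by
        apply eqT_far <;> (try dsimp only) <;> omega)
    have this' := e1.symm.trans (this.trans e2)
    simp only [ne_eq, Fin.ext_iff, incOminusInc_val] at this'
    rw [if_pos (by omega), if_neg (by omega)] at this'
    omega

section backward
open FirstOrder.Language

def ltPF {β : Type} (x y : β) : L2.Formula β :=
  Relations.formula₂ (L := L2) (TwoOrderRel.ltP : L2.Relations 2) (Term.var x) (Term.var y)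

def ltVF {β : Type} (x y : β) : L2.Formula β :=
  Relations.formula₂ (L := L2) (TwoOrderRel.ltV : L2.Relations 2) (Term.var x) (Term.var y)

theorem real_ltPF {β : Type} {n : ℕ} (σ : Equiv.Perm (Fin n)) (x y : β) (v : β → Fin n) :
    Real2 σ (ltPF x y) v ↔ v x < v y := by
  letI := permStruc2 σ
  exact Formula.realize_rel₂

theorem real_ltVF {β : Type} {n : ℕ} (σ : Equiv.Perm (Fin n)) (x y : β) (v : β → Fin n) :
    Real2 σ (ltVF x y) v ↔ σ (v x) < σ (v y) := by
  letI := permStruc2 σ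
  exact Formula.realize_rel₂

theorem real_not {β : Type} {n : ℕ} (σ : Equiv.Perm (Fin n)) (f : L2.Formula β) (v : β → Fin n) :
    Real2 σ (f.not) v ↔ ¬ Real2 σ f v := Iff.rfl

theorem real_inf {β : Type} {n : ℕ} (σ : Equiv.Perm (Fin n)) (f g : L2.Formula β)
    (v : β → Fin n) : Real2 σ (f ⊓ g) v ↔ Real2 σ f v ∧ Real2 σ g v := by
  letI := permStruc2 σ
  exact Formula.realize_inf

theorem real_iff {β : Type} {n : ℕ} (σ : Equiv.Perm (Fin n)) (f g : L2.Formula β)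
    (v : β → Fin n) : Real2 σ (f.iff g) v ↔ (Real2 σ f v ↔ Real2 σ g v) := by
  letI := permStruc2 σ
  exact Formula.realize_iff

theorem real_iInf {β γ : Type} [Finite γ] {n : ℕ} (σ : Equiv.Perm (Fin n))
    (f : γ → L2.Formula β) (v : β → Fin n) :
    Real2 σ (Formula.iInf f) v ↔ ∀ c, Real2 σ (f c) v := by
  letI := permStruc2 σ
  exact Formula.realize_iInf

theorem real_iExs {β γ : Type} [Finite γ] {n : ℕ} (σ : Equiv.Perm (Fin n))
    (f : L2.Formula (β ⊕ γ)) (v : β → Fin n) :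
    Real2 σ (f.iExs γ) v ↔ ∃ w : γ → Fin n, Real2 σ f (Sum.elim v w) := by
  letI := permStruc2 σ
  exact Formula.realize_iExs

noncomputable def atLeastF (N : ℕ) (θ : Fin N → L2.Formula (Fin 2 ⊕ Fin N)) : L2.Formula (Fin 2) :=
  Formula.iExs (Fin N)
    ((Formula.iInf fun p : {p : Fin N × Fin N // p.1 < p.2} =>
      ltPF (Sum.inr p.1.1) (Sum.inr p.1.2)) ⊓ Formula.iInf θ)

theorem card_ge_iff {n N : ℕ} (S : Finset (Fin n)) :
    N ≤ S.card ↔ ∃ w : Fin N → Fin n, (∀ p : {p : Fin N × Fin N // p.1 < p.2}, w p.1.1 < w p.1.2) ∧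
      ∀ i, w i ∈ S := by
  constructor
  · intro h
    obtain ⟨T, hT, hc⟩ := Finset.exists_subset_card_eq h
    exact ⟨T.orderEmbOfFin hc, fun p => (T.orderEmbOfFin hc).strictMono p.2,
      fun i => hT (T.orderEmbOfFin_mem hc i)⟩
  · rintro ⟨w, hw, hS⟩
    have hm : StrictMono w := fun i j hij => hw ⟨(i, j), hij⟩
    have := Finset.card_le_card_of_injOn (s := Finset.univ) w (fun i _ => hS i)
      (hm.injective.injOn)
    simpa using this

def setA {n : ℕ} (σ : Equiv.Perm (Fin n)) (a b : Fin n) : Finset (Fin n) :=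
  Finset.univ.filter fun x => x < b ∧ ¬ σ x < σ a

def setB {n : ℕ} (σ : Equiv.Perm (Fin n)) (a b : Fin n) : Finset (Fin n) :=
  Finset.univ.filter fun x => ¬ x < b ∧ σ x < σ a

noncomputable def atA (i j : Fin 2) (N : ℕ) : L2.Formula (Fin 2) :=
  atLeastF N fun x => ltPF (Sum.inr x) (Sum.inl j) ⊓ (ltVF (Sum.inr x) (Sum.inl i)).not

noncomputable def atB (i j : Fin 2) (N : ℕ) : L2.Formula (Fin 2) :=
  atLeastF N fun x => (ltPF (Sum.inr x) (Sum.inl j)).not ⊓ (ltVF (Sum.inr x) (Sum.inl i))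

theorem real_atA {n : ℕ} (σ : Equiv.Perm (Fin n)) (i j : Fin 2) (N : ℕ) (v : Fin 2 → Fin n) :
    Real2 σ (atA i j N) v ↔ N ≤ (setA σ (v i) (v j)).card := by
  rw [card_ge_iff]
  simp only [atA, atLeastF, real_iExs, real_inf, real_iInf, real_not, real_ltPF, real_ltVF,
    setA, Finset.mem_filter, Finset.mem_univ, true_and, Sum.elim_inl, Sum.elim_inr]

theorem real_atB {n : ℕ} (σ : Equiv.Perm (Fin n)) (i j : Fin 2) (N : ℕ) (v : Fin 2 → Fin n) :
    Real2 σ (atB i j N) v ↔ N ≤ (setB σ (v i) (v j)).card := by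
  rw [card_ge_iff]
  simp only [atB, atLeastF, real_iExs, real_inf, real_iInf, real_not, real_ltPF, real_ltVF,
    setB, Finset.mem_filter, Finset.mem_univ, true_and, Sum.elim_inl, Sum.elim_inr]

noncomputable def imF (K : ℕ) (i j : Fin 2) : L2.Formula (Fin 2) :=
  Formula.iInf fun N : Fin K => (atA i j N).iff (atB i j N)

theorem card_filter_lt' {n : ℕ} (b : Fin n) :
    (Finset.univ.filter fun x => x < b).card = b := by
  have : (Finset.univ.filter fun x => x < b) = Finset.Iio b := by ext x; simp
  rw [this, Fin.card_Iio]

theorem card_eq_iff {n : ℕ} (σ : Equiv.Perm (Fin n)) (a b : Fin n) :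
    (setA σ a b).card = (setB σ a b).card ↔ σ a = b := by
  have h1 : (setA σ a b).card + (Finset.univ.filter fun x => x < b ∧ σ x < σ a).card = b := by
    rw [add_comm, ← Finset.filter_filter, setA, ← Finset.filter_filter,
      Finset.card_filter_add_card_filter_not]
    exact card_filter_lt' b
  have h2 : (setB σ a b).card + (Finset.univ.filter fun x => x < b ∧ σ x < σ a).card = σ a := by
    have e : ∀ x, (x < b ∧ σ x < σ a) ↔ (σ x < σ a ∧ x < b) := fun x => and_comm
    have e' : ∀ x, (¬ x < b ∧ σ x < σ a) ↔ (σ x < σ a ∧ ¬ x < b) := fun x => and_comm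
    simp only [setB, e, e']
    rw [add_comm, ← Finset.filter_filter, ← Finset.filter_filter,
      Finset.card_filter_add_card_filter_not]
    have : (Finset.univ.filter fun x => σ x < σ a) = (Finset.univ.filter fun x => x < σ a).map
        σ.symm.toEmbedding := by
      ext x; simp
    rw [this, Finset.card_map]
    exact card_filter_lt' (σ a)
  rw [Fin.ext_iff]
  omega

theorem es {n m : ℕ} (σ : Equiv.Perm (Fin n)) (k : ℕ) (S : Finset (Fin n)) (hS : k * m ≤ S.card) :
    (∃ T ⊆ S, T.card = m ∧ ∀ x ∈ T, ∀ y ∈ T, x < y → σ x < σ y) ∨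
    (∃ T ⊆ S, T.card = k ∧ ∀ x ∈ T, ∀ y ∈ T, x < y → σ y < σ x) := by
  classical
  induction k generalizing S with
  | zero => exact Or.inr ⟨∅, by simp, by simp, by simp⟩
  | succ k ih =>
    let M := S.filter fun x => ∀ y ∈ S, y < x → ¬ σ x < σ y
    by_cases hM : m ≤ M.card
    · left
      obtain ⟨T, hT, hc⟩ := Finset.exists_subset_card_eq hM
      refine ⟨T, hT.trans (Finset.filter_subset _ _), hc, fun x hx y hy hxy => ?_⟩
      have h1 := Finset.mem_filter.1 (hT hx)
      have h2 := Finset.mem_filter.1 (hT hy)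
      exact lt_of_le_of_ne (not_lt.1 (h2.2 x h1.1 hxy)) (fun h => hxy.ne (σ.injective h))
    · have hMS : M ⊆ S := Finset.filter_subset _ _
      have hc : k * m ≤ (S \ M).card := by
        rw [Finset.card_sdiff_of_subset hMS]
        rw [Nat.succ_mul] at hS
        omega
      rcases ih (S \ M) hc with ⟨T, hT, h⟩ | ⟨T, hT, h, h'⟩
      · exact Or.inl ⟨T, hT.trans Finset.sdiff_subset, h⟩
      · right
        rcases T.eq_empty_or_nonempty with rfl | hne
        · have : 0 < S.card := by
            simp at h
            subst h
            omega
          obtain ⟨x, hx⟩ := Finset.card_pos.1 this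
          simp at h
          subst h
          refine ⟨{x}, by simpa using hx, by simp, ?_⟩
          intro y hy z hz
          simp at hy hz
          subst hy; subst hz
          simp
        · have hxT := T.min'_mem hne
          have hmin : ∀ z ∈ T, T.min' hne ≤ z := fun z hz => T.min'_le z hz
          generalize T.min' hne = x at hxT hmin
          have hxS := Finset.mem_sdiff.1 (hT hxT)
          have : ∃ y ∈ S, y < x ∧ σ x < σ y := by
            by_contra hcon
            push Not at hcon
            exact hxS.2 (Finset.mem_filter.2 ⟨hxS.1, fun y hy hyx => not_lt.2 (hcon y hy hyx)⟩)
          obtain ⟨y, hyS, hyx, hσ⟩ := this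
          have hlt : ∀ z ∈ T, y < z := fun z hz => hyx.trans_le (hmin z hz)
          have hσ' : ∀ z ∈ T, σ z < σ y := by
            intro z hz
            rcases (hmin z hz).eq_or_lt with rfl | hz'
            · exact hσ
            · exact (h' x hxT z hz hz').trans hσ
          refine ⟨insert y T, ?_, ?_, ?_⟩
          · exact Finset.insert_subset hyS (hT.trans Finset.sdiff_subset)
          · rw [Finset.card_insert_of_notMem (fun hy => (hlt y hy).false), h]
          · intro p hp q hq hpq
            rcases Finset.mem_insert.1 hp with hp1 | hp1 <;>
              rcases Finset.mem_insert.1 hq with hq1 | hq1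
            · exact absurd (hp1.trans hq1.symm) hpq.ne
            · rw [hp1]; exact hσ' q hq1
            · rw [hq1] at hpq; exact absurd (hpq.trans (hlt p hp1)) (lt_irrefl _)
            · exact h' p hp1 q hq1 hpq

theorem occ_rev_s16 {n k : ℕ} (σ : Equiv.Perm (Fin n)) (T : Finset (Fin n)) (hT : T.card = k)
    (h : ∀ x ∈ T, ∀ y ∈ T, x < y → σ y < σ x) :
    ∃ a, IsOccurrence (Fin.revPerm : Equiv.Perm (Fin k)) σ a := by
  have hm := (T.orderEmbOfFin hT).strictMono
  refine ⟨T.orderEmbOfFin hT, hm, fun i j => ?_⟩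
  simp only [Fin.revPerm_apply, Fin.rev_lt_rev]
  have f := fun i j (hij : i < j) => h _ (T.orderEmbOfFin_mem hT i) _ (T.orderEmbOfFin_mem hT j) (hm hij)
  constructor
  · intro hl
    by_contra hc
    rcases (not_lt.1 hc).eq_or_lt with rfl | hc
    · exact hl.false
    · exact (hl.trans (f _ _ hc)).false
  · exact f j i

theorem occ_inc {N m n : ℕ} (σ : Equiv.Perm (Fin N)) (T U : Finset (Fin N)) (hT : T.card = m)
    (hU : U.card = n)
    (h : ∀ x ∈ T, ∀ y ∈ T, x < y → σ x < σ y) (h' : ∀ x ∈ U, ∀ y ∈ U, x < y → σ x < σ y)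
    (hTU : ∀ x ∈ T, ∀ y ∈ U, x < y ∧ σ y < σ x) :
    ∃ a, IsOccurrence (incOminusInc m n) σ a := by
  let f := T.orderEmbOfFin hT
  let g := U.orderEmbOfFin hU
  have hf : ∀ i, f i ∈ T := T.orderEmbOfFin_mem hT
  have hg : ∀ i, g i ∈ U := U.orderEmbOfFin_mem hU
  have hsf : StrictMono (σ ∘ f) := fun i j hij => h _ (hf i) _ (hf j) (f.strictMono hij)
  have hsg : StrictMono (σ ∘ g) := fun i j hij => h' _ (hg i) _ (hg j) (g.strictMono hij)
  refine ⟨Fin.addCases f g, ?_, ?_⟩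
  · intro i j
    refine Fin.addCases (fun i => ?_) (fun i => ?_) i <;>
      refine Fin.addCases (fun j => ?_) (fun j => ?_) j <;> intro hij <;>
      simp only [Fin.addCases_left, Fin.addCases_right] <;>
      simp only [Fin.lt_def, Fin.val_castAdd, Fin.val_natAdd] at hij
    · exact f.strictMono hij
    · exact (hTU _ (hf i) _ (hg j)).1
    · omega
    · exact g.strictMono (by rw [Fin.lt_def]; omega)
  · intro i j
    rw [Fin.lt_def (a := incOminusInc m n i), incOminusInc_val, incOminusInc_val]
    refine Fin.addCases (fun i => ?_) (fun i => ?_) i <;>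
      refine Fin.addCases (fun j => ?_) (fun j => ?_) j <;>
      simp only [Fin.addCases_left, Fin.addCases_right, Fin.val_castAdd, Fin.val_natAdd] <;>
      have hi := i.isLt <;> have hj := j.isLt
    · rw [if_pos hi, if_pos hj]
      refine (hsf.lt_iff_lt (a := i) (b := j)).trans ?_
      rw [Fin.lt_def]; omega
    · rw [if_pos hi, if_neg (by omega)]
      have := (hTU _ (hf i) _ (hg j)).2
      constructor
      · intro hh; exact absurd (hh.trans this) (lt_irrefl _)
      · intro hh; omega
    · rw [if_neg (by omega), if_pos hj]
      have := (hTU _ (hf j) _ (hg i)).2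
      constructor
      · intro hh; omega
      · intro hh; exact this
    · rw [if_neg (by omega), if_neg (by omega)]
      refine (hsg.lt_iff_lt (a := i) (b := j)).trans ?_
      rw [Fin.lt_def]; omega

theorem backward_dir (C : Set Perms) (hC : PermClass C) (k m n : ℕ)
    (hk : (⟨k, (Fin.revPerm : Equiv.Perm (Fin k))⟩ : Perms) ∉ C)
    (hmn : (⟨m + n, incOminusInc m n⟩ : Perms) ∉ C) :
    ∃ φ : L2.Formula (Fin 2), ∀ (n : ℕ) (σ : Equiv.Perm (Fin n)),
        (⟨n, σ⟩ : Perms) ∈ C → ∀ a b : Fin n,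
          (Real2 σ φ ![a, b] ↔ (a ≠ b ∧ σ a = b ∧ σ b = a)) := by
  let K := k * m + k * n + 1
  have main : ∀ (N : ℕ) (σ : Equiv.Perm (Fin N)), (⟨N, σ⟩ : Perms) ∈ C → ∀ (i j : Fin 2)
      (v : Fin 2 → Fin N), Real2 σ (imF K i j) v ↔ σ (v i) = v j := by
    intro N σ hσ i j v
    rw [← card_eq_iff]
    simp only [imF, real_iInf, real_iff, real_atA, real_atB]
    constructor
    · intro h
      have hle : (setA σ (v i) (v j)).card < k * m ∨ (setB σ (v i) (v j)).card < k * n := by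
        by_contra hcon
        push Not at hcon
        rcases es σ k _ hcon.1 with ⟨T, hT, hTc, hTi⟩ | ⟨T, hT, hTc, hTi⟩
        · rcases es σ k _ hcon.2 with ⟨U, hU, hUc, hUi⟩ | ⟨U, hU, hUc, hUi⟩
          · refine hmn (hC _ hσ _ (occ_inc σ T U hTc hUc hTi hUi fun x hx y hy => ?_))
            have h1 := (Finset.mem_filter.1 (hT hx)).2
            have h2 := (Finset.mem_filter.1 (hU hy)).2
            exact ⟨h1.1.trans_le (not_lt.1 h2.1), h2.2.trans_le (not_lt.1 h1.2)⟩
          · exact hk (hC _ hσ _ (occ_rev_s16 σ U hUc hUi))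
        · exact hk (hC _ hσ _ (occ_rev_s16 σ T hTc hTi))
      have h1 : ∀ c, c < K → (c ≤ (setA σ (v i) (v j)).card ↔ c ≤ (setB σ (v i) (v j)).card) :=
        fun c hc => h ⟨c, hc⟩
      simp only [K] at h1
      generalize (setA σ (v i) (v j)).card = A at *
      generalize (setB σ (v i) (v j)).card = B at *
      generalize k * m = p at *
      generalize k * n = q at *
      by_contra hne
      rcases Nat.lt_or_gt_of_ne hne with hl | hl
      · rcases hle with hle | hle
        · have := h1 (A + 1) (by omega); omega
        · have := h1 (A + 1) (by omega); omega
      · rcases hle with hle | hle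
        · have := h1 (B + 1) (by omega); omega
        · have := h1 (B + 1) (by omega); omega
    · intro h c
      rw [h]
  refine ⟨(ltPF 0 1).not.imp (ltPF 1 0) ⊓ (imF K 0 1 ⊓ imF K 1 0), fun N σ hσ a b => ?_⟩
  rw [real_inf, real_inf, main N σ hσ, main N σ hσ]
  have : Real2 σ ((ltPF (0 : Fin 2) 1).not.imp (ltPF 1 0)) ![a, b] ↔ a ≠ b := by
    change (¬ Real2 σ (ltPF (0 : Fin 2) 1) ![a, b] → Real2 σ (ltPF (1 : Fin 2) 0) ![a, b]) ↔ _
    rw [real_ltPF, real_ltPF]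
    simp only [Matrix.cons_val_zero, Matrix.cons_val_one]
    rw [ne_iff_lt_or_gt]
    tauto
  rw [this]
  simp

end backward

theorem transposition_expressible_in_class_iff (C : Set Perms) (hC : PermClass C) :
    (∃ φ : L2.Formula (Fin 2), ∀ (n : ℕ) (σ : Equiv.Perm (Fin n)),
        (⟨n, σ⟩ : Perms) ∈ C → ∀ a b : Fin n,
          (Real2 σ φ ![a, b] ↔ (a ≠ b ∧ σ a = b ∧ σ b = a))) ↔
      (∃ k m n : ℕ, 2 ≤ k ∧ 1 ≤ m ∧ 1 ≤ n ∧
        (⟨k, (Fin.revPerm : Equiv.Perm (Fin k))⟩ : Perms) ∉ C ∧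
        (⟨m + n, incOminusInc m n⟩ : Perms) ∉ C) := by
  constructor
  · rintro ⟨φ, hφ⟩
    exact forward_dir C φ hφ
  · rintro ⟨k, m, n, _, _, _, hk, hmn⟩
    exact backward_dir C hC k m n hk hmn
end

section
/- Let m ≥ 1 and let A be an m×m matrix with non-negative integer entries such that for every index i, the sum of the entries of row i equals the sum of the entries of column i. Then A can be written as a finite sum of cycle matrices (equivalently, as a linear combination of cycle matrices with non-negative integer coefficients). -/
open FirstOrder

/-- The cycle matrix associated to a nonempty sequence `c : Fin (r+1) → Fin m` (intended
to have pairwise distinct entries): the adjacency matrix of the directed cycle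
`c 0 → c 1 → ⋯ → c r → c 0`. -/
def cycleMatrix {m : ℕ} (r : ℕ) (c : Fin (r + 1) → Fin m) : Matrix (Fin m) (Fin m) ℕ :=
  fun a b => (Finset.univ.filter fun t : Fin (r + 1) => c t = a ∧ c (t + 1) = b).card

theorem cycleMatrix_row {m r : ℕ} (c : Fin (r + 1) → Fin m) (i : Fin m) :
    ∑ j, cycleMatrix r c i j = (Finset.univ.filter fun t : Fin (r + 1) => c t = i).card := by
  rw [Finset.card_eq_sum_card_fiberwise (f := fun t => c (t + 1)) (t := Finset.univ)
    (fun _ _ => Finset.mem_coe.2 (Finset.mem_univ _))]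
  simp only [cycleMatrix, Finset.filter_filter]

theorem cycleMatrix_col {m r : ℕ} (c : Fin (r + 1) → Fin m) (i : Fin m) :
    ∑ j, cycleMatrix r c j i =
      (Finset.univ.filter fun t : Fin (r + 1) => c (t + 1) = i).card := by
  rw [Finset.card_eq_sum_card_fiberwise (f := fun t => c t) (t := Finset.univ)
    (fun _ _ => Finset.mem_coe.2 (Finset.mem_univ _))]
  simp only [cycleMatrix, Finset.filter_filter, and_comm]

theorem cycleMatrix_bal {m r : ℕ} (c : Fin (r + 1) → Fin m) (i : Fin m) :
    ∑ j, cycleMatrix r c i j = ∑ j, cycleMatrix r c j i := by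
  rw [cycleMatrix_row, cycleMatrix_col]
  symm
  apply Finset.card_equiv (Equiv.addRight (1 : Fin (r + 1)))
  intro t
  simp

theorem exists_cycle {m : ℕ} (A : Matrix (Fin m) (Fin m) ℕ)
    (hA : ∀ i, ∑ j, A i j = ∑ j, A j i) (h0 : A ≠ 0) :
    ∃ (r : ℕ) (c : Fin (r + 1) → Fin m), Function.Injective c ∧
      ∀ t, 0 < A (c t) (c (t + 1)) := by
  classical
  have hex : ∃ a b, 0 < A a b := by
    by_contra! h
    exact h0 (by ext a b; simpa using h a b)
  have hstep : ∀ i j, 0 < A i j → ∃ k, 0 < A j k := by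
    intro i j hij
    by_contra! h
    have h1 : ∑ k, A j k = 0 := Finset.sum_eq_zero fun k _ => Nat.le_zero.1 (h k)
    have h2 : A i j ≤ ∑ k, A k j :=
      Finset.single_le_sum (f := fun k => A k j) (fun _ _ => Nat.zero_le _) (Finset.mem_univ i)
    have := hA j
    omega
  have hf : ∀ i, ∃ k, (∃ j, 0 < A i j) → 0 < A i k := by
    intro i
    by_cases h : ∃ j, 0 < A i j
    · exact ⟨h.choose, fun _ => h.choose_spec⟩
    · exact ⟨i, fun h' => absurd h' h⟩
  choose f hf using hf
  obtain ⟨a, hab⟩ := hex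
  have hiter : ∀ n, ∃ j, 0 < A (f^[n] a) j := by
    intro n
    induction n with
    | zero => exact hab
    | succ n ih =>
      rw [Function.iterate_succ_apply']
      exact hstep _ _ (hf _ ih)
  obtain ⟨x, y, hxy, he⟩ : ∃ x y : ℕ, x < y ∧ f^[x] a = f^[y] a := by
    obtain ⟨x, y, hne, he⟩ := Finite.exists_ne_map_eq_of_infinite (fun n : ℕ => f^[n] a)
    rcases lt_or_gt_of_ne hne with h | h
    · exact ⟨x, y, h, he⟩
    · exact ⟨y, x, h, he.symm⟩
  set p := f^[x] a with hp
  have hper : p ∈ Function.periodicPts f := by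
    refine ⟨y - x, by omega, ?_⟩
    change f^[y - x] p = p
    rw [hp, ← Function.iterate_add_apply, Nat.sub_add_cancel hxy.le, ← he]
  obtain ⟨r, hr⟩ : ∃ r, Function.minimalPeriod f p = r + 1 :=
    ⟨_, (Nat.succ_pred_eq_of_pos (Function.minimalPeriod_pos_of_mem_periodicPts hper)).symm⟩
  refine ⟨r, fun t => f^[t.val] p, ?_, ?_⟩
  · intro s t hst
    apply Fin.ext
    exact (Function.iterate_eq_iterate_iff_of_lt_minimalPeriod
      (by rw [hr]; exact s.2) (by rw [hr]; exact t.2)).1 hst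
  · intro t
    have h1 : f^[(t + 1 : Fin (r + 1)).val] p = f (f^[t.val] p) := by
      rw [← Function.iterate_succ_apply' f, ← Function.iterate_mod_minimalPeriod_eq (n := t.val.succ),
        hr, Fin.val_add]
      simp [Nat.add_mod]
    simp only [h1]
    apply hf
    rw [hp, ← Function.iterate_add_apply]
    exact hiter _

theorem cycleMatrix_le {m r : ℕ} (A : Matrix (Fin m) (Fin m) ℕ) (c : Fin (r + 1) → Fin m)
    (hc : Function.Injective c) (h : ∀ t, 0 < A (c t) (c (t + 1))) (a b : Fin m) :
    cycleMatrix r c a b ≤ A a b := by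
  unfold cycleMatrix
  rcases Finset.eq_empty_or_nonempty
    (Finset.univ.filter fun t : Fin (r + 1) => c t = a ∧ c (t + 1) = b) with he | ⟨t, ht⟩
  · rw [he]; simp
  · simp only [Finset.mem_filter, Finset.mem_univ, true_and] at ht
    have h2 := h t
    rw [ht.1, ht.2] at h2
    refine le_trans (Finset.card_le_one.2 ?_) h2
    intro u hu v hv
    simp only [Finset.mem_filter, Finset.mem_univ, true_and] at hu hv
    exact hc (hu.1.trans hv.1.symm)

theorem decomp_aux {m : ℕ} (n : ℕ) : ∀ (A : Matrix (Fin m) (Fin m) ℕ),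
    (∀ i, ∑ j, A i j = ∑ j, A j i) → ∑ i, ∑ j, A i j ≤ n →
    ∃ L : List (Σ r : ℕ, Fin (r + 1) → Fin m),
      (∀ c ∈ L, Function.Injective c.2) ∧
      A = (L.map fun c => cycleMatrix c.1 c.2).sum := by
  induction n with
  | zero =>
    intro A _ h
    refine ⟨[], by simp, ?_⟩
    ext a b
    simp at h
    simp [h]
  | succ n ih =>
    intro A hA h
    by_cases h0 : A = 0
    · exact ⟨[], by simp, by simp [h0]⟩
    obtain ⟨r, c, hc, hpos⟩ := exists_cycle A hA h0
    have hle := cycleMatrix_le A c hc hpos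
    obtain ⟨B, hB⟩ : ∃ B : Matrix (Fin m) (Fin m) ℕ, A = cycleMatrix r c + B :=
      ⟨fun a b => A a b - cycleMatrix r c a b, by
        ext a b; exact (Nat.add_sub_cancel' (hle a b)).symm⟩
    subst hB
    have hone : 0 < ∑ i, ∑ j, cycleMatrix r c i j := by
      refine Finset.sum_pos' (fun _ _ => Nat.zero_le _) ⟨c 0, Finset.mem_univ _, ?_⟩
      rw [cycleMatrix_row]
      exact Finset.card_pos.2 ⟨0, by simp⟩
    simp only [Matrix.add_apply, Finset.sum_add_distrib] at h hA
    obtain ⟨L, hL, hs⟩ := ih B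
      (fun i => by have := hA i; rw [cycleMatrix_bal c i] at this; omega) (by omega)
    refine ⟨⟨r, c⟩ :: L, ?_, ?_⟩
    · intro d hd
      rcases List.mem_cons.1 hd with rfl | hd
      · exact hc
      · exact hL d hd
    · rw [List.map_cons, List.sum_cons, ← hs]

theorem matching_marginals_sum_of_cycle_matrices (m : ℕ) (hm : 1 ≤ m)
    (A : Matrix (Fin m) (Fin m) ℕ) (hA : ∀ i, ∑ j, A i j = ∑ j, A j i) :
    ∃ L : List (Σ r : ℕ, Fin (r + 1) → Fin m),
      (∀ c ∈ L, Function.Injective c.2) ∧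
      A = (L.map fun c => cycleMatrix c.1 c.2).sum := by
  exact decomp_aux _ A hA le_rfl
end

section
/- Let E be a set of permutations for which there exist both an L2-sentence φ₂ such that for every n and every permutation σ of {1,…,n}, M_σ satisfies φ₂ if and only if σ ∈ E, and an L1-sentence φ₁ such that for every n and every permutation σ of {1,…,n}, N_σ satisfies φ₁ if and only if σ ∈ E. Then either there exists M such that every permutation whose support has size at least M belongs to E, or there exists M such that every permutation in E has support of size at most M. -/
open FirstOrder

/-- Relation symbols of the language `L1` (TOOB): one binary relation symbol `R`. -/
inductive OneBijRel : ℕ → Type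
  | R : OneBijRel 2

/-- The first-order language `L1` with exactly one binary relation symbol `R`. -/
def L1 : FirstOrder.Language := ⟨fun _ => Empty, OneBijRel⟩

/-- The `L1`-structure `N_σ` associated to a permutation `σ` of `{1,…,n}`:
the domain is `Fin n` and `i R j` is interpreted as `σ i = j`. -/
def permStruc1 {n : ℕ} (σ : Equiv.Perm (Fin n)) : L1.Structure (Fin n) where
  funMap := fun {_} f _ => Empty.elim f
  RelMap
    | .R => fun x => σ (x 0) = x 1

/-- Satisfaction of an `L1`-sentence in the structure `N_σ`. -/
def Sat1 {n : ℕ} (σ : Equiv.Perm (Fin n)) (φ : L1.Sentence) : Prop :=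
  letI := permStruc1 σ
  (Fin n) ⊨ φ

/-- A set of permutations is TOOB-definable if some `L1`-sentence defines it. -/
def TOOBDef (E : Set Perms) : Prop :=
  ∃ φ : L1.Sentence, ∀ (n : ℕ) (σ : Equiv.Perm (Fin n)), Sat1 σ φ ↔ (⟨n, σ⟩ : Perms) ∈ E


namespace TT

def near (K a b : ℤ) : Prop := a = b ∨ (K ≤ a ∧ K ≤ b) ∨ (a ≤ -K ∧ b ≤ -K)

def Good (r : ℕ) (S : Finset (ℤ × ℤ)) : Prop :=
  ∀ s ∈ S, ∀ t ∈ S, near (2 ^ r) (s.1 - t.1) (s.2 - t.2)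

lemma near_neg {K a b : ℤ} (h : near K a b) : near K (-a) (-b) := by
  unfold near at *; omega

lemma near_swap {K a b : ℤ} (h : near K a b) : near K b a := by
  unfold near at *; omega

lemma Good.mono {r r' : ℕ} (h : r' ≤ r) {S : Finset (ℤ × ℤ)} (hS : Good r S) : Good r' S := by
  intro s hs t ht
  have h1 := hS s hs t ht
  have h2 : (2 : ℤ) ^ r' ≤ 2 ^ r := pow_le_pow_right₀ (by norm_num) h
  unfold near at *; omega

lemma Good.swap {r : ℕ} {S : Finset (ℤ × ℤ)} (hS : Good r S) : Good r (S.image Prod.swap) := by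
  intro s hs t ht
  simp only [Finset.mem_image] at hs ht
  obtain ⟨s, hs, rfl⟩ := hs
  obtain ⟨t, ht, rfl⟩ := ht
  exact near_swap (hS s hs t ht)

lemma Good.extend {r : ℕ} {S : Finset (ℤ × ℤ)} (hS : Good (r + 1) S) (p : ℤ)
    {lo hi : ℤ × ℤ} (hlo : lo ∈ S) (hhi : hi ∈ S) (h1 : lo.1 < p) (h2 : p < hi.1) :
    ∃ p', lo.2 < p' ∧ p' < hi.2 ∧ Good r (insert (p, p') S) := by
  obtain ⟨s, hs, hsmax⟩ := (S.filter (fun q => q.1 ≤ p)).exists_max_image (fun q => q.1)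
    ⟨lo, by simp [hlo]; omega⟩
  obtain ⟨t, ht, htmin⟩ := (S.filter (fun q => p ≤ q.1)).exists_min_image (fun q => q.1)
    ⟨hi, by simp [hhi]; omega⟩
  simp only [Finset.mem_filter] at hs ht hsmax htmin
  have hK : (1 : ℤ) ≤ 2 ^ r := one_le_pow₀ (by norm_num)
  have hK2 : (2 : ℤ) ^ (r + 1) = 2 * 2 ^ r := by ring
  unfold Good at hS
  rw [hK2] at hS
  generalize hKK : (2 : ℤ) ^ r = K at *
  have hst := hS t ht.1 s hs.1
  have key : ∃ p', near K (p - s.1) (p' - s.2) ∧ near K (t.1 - p) (t.2 - p') := by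
    unfold near at *
    by_cases c1 : p - s.1 < K
    · exact ⟨s.2 + (p - s.1), by omega, by omega⟩
    · by_cases c2 : t.1 - p < K
      · exact ⟨t.2 - (t.1 - p), by omega, by omega⟩
      · exact ⟨s.2 + K, by omega, by omega⟩
  obtain ⟨p', k1, k2⟩ := key
  have main : ∀ q ∈ S, near K (p - q.1) (p' - q.2) := by
    intro q hq
    have a1 := hS q hq s hs.1
    have a2 := hS q hq t ht.1
    by_cases c : q.1 ≤ p
    · have := hsmax q ⟨hq, c⟩
      unfold near at *; omega
    · have := htmin q ⟨hq, by omega⟩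
      unfold near at *; omega
  refine ⟨p', ?_, ?_, ?_⟩
  · have := main lo hlo
    unfold near at this; omega
  · have := main hi hhi
    unfold near at this; omega
  · intro a ha b hb
    rw [hKK]
    rw [Finset.mem_insert] at ha hb
    rcases ha with rfl | ha <;> rcases hb with rfl | hb
    · left; simp
    · exact main b hb
    · have := near_neg (main a ha)
      simpa using this
    · have := hS a ha b hb
      unfold near at *; omega

def qr {n : ℕ} : L2.BoundedFormula Empty n → ℕ
  | .falsum => 0
  | .equal _ _ => 0
  | .rel _ _ => 0
  | .imp a b => max (qr a) (qr b)
  | .all a => qr a + 1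

def Sim {m m' : ℕ} {U : Type} (r : ℕ) {k : ℕ} (v : Fin k → Fin m ⊕ U) (v' : Fin k → Fin m' ⊕ U) :
    Prop :=
  ∃ S : Finset (ℤ × ℤ), Good r S ∧ ((-1, -1) : ℤ × ℤ) ∈ S ∧ ((m, m') : ℤ × ℤ) ∈ S ∧
    ∀ i, (∃ u, v i = .inr u ∧ v' i = .inr u) ∨
      ∃ a b, v i = .inl a ∧ v' i = .inl b ∧ (((a : ℕ) : ℤ), ((b : ℕ) : ℤ)) ∈ S

lemma Sim.symm {m m' : ℕ} {U : Type} {r : ℕ} {k : ℕ} {v : Fin k → Fin m ⊕ U}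
    {v' : Fin k → Fin m' ⊕ U} (h : Sim r v v') : Sim r v' v := by
  obtain ⟨S, h1, h2, h3, h4⟩ := h
  refine ⟨S.image Prod.swap, h1.swap, ?_, ?_, ?_⟩
  · exact Finset.mem_image.2 ⟨_, h2, rfl⟩
  · exact Finset.mem_image.2 ⟨_, h3, rfl⟩
  · intro i
    rcases h4 i with ⟨u, a, b⟩ | ⟨a, b, c, d, e⟩
    · exact .inl ⟨u, b, a⟩
    · exact .inr ⟨b, a, d, c, Finset.mem_image.2 ⟨_, e, rfl⟩⟩

lemma Sim.mono {m m' : ℕ} {U : Type} {r r' : ℕ} (hr : r' ≤ r) {k : ℕ} {v : Fin k → Fin m ⊕ U}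
    {v' : Fin k → Fin m' ⊕ U} (h : Sim r v v') : Sim r' v v' := by
  obtain ⟨S, h1, h2⟩ := h
  exact ⟨S, h1.mono hr, h2⟩

lemma Sim.forth {m m' : ℕ} {U : Type} {r : ℕ} {k : ℕ} {v : Fin k → Fin m ⊕ U}
    {v' : Fin k → Fin m' ⊕ U} (h : Sim (r + 1) v v') (y : Fin m ⊕ U) :
    ∃ y', Sim r (Fin.snoc v y : Fin (k + 1) → _) (Fin.snoc v' y' : Fin (k + 1) → _) := by
  obtain ⟨S, h1, h2, h3, h4⟩ := h
  rcases y with a | u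
  · obtain ⟨p', g1, g2, g3⟩ := h1.extend ((a : ℕ) : ℤ) h2 h3 (by simp; omega) (by simp)
    simp only at g1 g2
    lift p' to ℕ using (by omega)
    refine ⟨.inl ⟨p', by omega⟩, _, g3, by simp [h2], by simp [h3], ?_⟩
    intro i
    refine Fin.lastCases ?_ (fun i => ?_) i
    · right; exact ⟨a, ⟨p', by omega⟩, by simp, by simp, by simp⟩
    · simp only [Fin.snoc_castSucc]
      rcases h4 i with h | ⟨a, b, c, d, e⟩
      · exact .inl h
      · exact .inr ⟨a, b, c, d, Finset.mem_insert_of_mem e⟩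
  · refine ⟨.inr u, S, h1.mono (by omega), h2, h3, ?_⟩
    intro i
    refine Fin.lastCases ?_ (fun i => ?_) i
    · left; exact ⟨u, by simp, by simp⟩
    · simpa only [Fin.snoc_castSucc] using h4 i

/-- compatibility data of two maps on a block -/
structure Blk {m m' n n' : ℕ} {U : Type} (x : Fin m ⊕ U → Fin n) (x' : Fin m' ⊕ U → Fin n') :
    Prop where
  uu : ∀ u v, x (.inr u) < x (.inr v) ↔ x' (.inr u) < x' (.inr v)
  au : ∀ a a' u, x (.inl a) < x (.inr u) ↔ x' (.inl a') < x' (.inr u)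
  ua : ∀ a a' u, x (.inr u) < x (.inl a) ↔ x' (.inr u) < x' (.inl a')
  aa : (StrictMono (x ∘ Sum.inl) ∧ StrictMono (x' ∘ Sum.inl)) ∨
    (StrictAnti (x ∘ Sum.inl) ∧ StrictAnti (x' ∘ Sum.inl))

lemma Blk.lt_iff {m m' n n' : ℕ} {U : Type} {x : Fin m ⊕ U → Fin n} {x' : Fin m' ⊕ U → Fin n'}
    (h : Blk x x') {r k : ℕ} {v : Fin k → Fin m ⊕ U}
    {v' : Fin k → Fin m' ⊕ U} (hs : Sim r v v') (i j : Fin k) :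
    x (v i) < x (v j) ↔ x' (v' i) < x' (v' j) := by
  obtain ⟨S, h1, h2, h3, h4⟩ := hs
  rcases h4 i with ⟨u, e1, e2⟩ | ⟨a, b, e1, e2, e3⟩ <;>
  rcases h4 j with ⟨u', f1, f2⟩ | ⟨a', b', f1, f2, f3⟩ <;> rw [e1, e2, f1, f2]
  · exact h.uu _ _
  · exact h.ua _ _ _
  · exact h.au _ _ _
  · have hn := h1 _ e3 _ f3
    have hK : (1 : ℤ) ≤ 2 ^ r := one_le_pow₀ (by norm_num)
    unfold near at hn
    simp only at hn
    rcases h.aa with ⟨p, q⟩ | ⟨p, q⟩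
    · have p := p.lt_iff_lt (a := a) (b := a')
      have q := q.lt_iff_lt (a := b) (b := b')
      simp only [Function.comp] at p q
      rw [p, q, Fin.lt_def, Fin.lt_def]; omega
    · have p := p.lt_iff_gt (a := a) (b := a')
      have q := q.lt_iff_gt (a := b) (b := b')
      simp only [Function.comp] at p q
      rw [p, q, Fin.lt_def, Fin.lt_def]; omega

lemma ef {m m' n n' : ℕ} {U : Type} {σ : Equiv.Perm (Fin n)} {σ' : Equiv.Perm (Fin n')}
    (x : Fin m ⊕ U ≃ Fin n) (x' : Fin m' ⊕ U ≃ Fin n')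
    (hP : Blk x x') (hV : Blk (σ ∘ x) (σ' ∘ x')) {k : ℕ} (φ : L2.BoundedFormula Empty k) :
    ∀ (r : ℕ) (_ : qr φ ≤ r) (v : Fin k → Fin m ⊕ U)
    (v' : Fin k → Fin m' ⊕ U) (_ : Sim r v v'),
    (@Language.BoundedFormula.Realize L2 (Fin n) (permStruc2 σ) _ _ φ Empty.elim (x ∘ v) ↔
    @Language.BoundedFormula.Realize L2 (Fin n') (permStruc2 σ') _ _ φ Empty.elim (x' ∘ v')) := by
  induction φ with
  | falsum => intros; rfl
  | @equal k t₁ t₂ =>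
    intro r _ v v' hs
    rcases t₁ with (e | i) | ⟨f, _⟩
    · exact e.elim
    rotate_left
    · exact Empty.elim f
    rcases t₂ with (e | j) | ⟨f, _⟩
    · exact e.elim
    rotate_left
    · exact Empty.elim f
    have a1 := hP.lt_iff hs i j
    have a2 := hP.lt_iff hs j i
    change x (v i) = x (v j) ↔ x' (v' i) = x' (v' j)
    rw [Fin.lt_def, Fin.lt_def] at a1 a2
    rw [Fin.ext_iff, Fin.ext_iff]
    omega
  | @rel k l R ts =>
    intro r _ v v' hs
    have tv : ∀ i, ∃ j, ts i = .var (.inr j) := by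
      intro i
      rcases h : ts i with (e | j) | ⟨f, _⟩
      · exact e.elim
      · exact ⟨j, rfl⟩
      · exact Empty.elim f
    cases R with
    | ltP =>
      obtain ⟨i, hi⟩ := tv 0
      obtain ⟨j, hj⟩ := tv 1
      letI := permStruc2 σ
      letI := permStruc2 σ'
      change Language.Term.realize _ (ts 0) < Language.Term.realize _ (ts 1) ↔
        Language.Term.realize _ (ts 0) < Language.Term.realize _ (ts 1)
      rw [hi, hj]
      exact hP.lt_iff hs i j
    | ltV =>
      obtain ⟨i, hi⟩ := tv 0
      obtain ⟨j, hj⟩ := tv 1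
      letI := permStruc2 σ
      letI := permStruc2 σ'
      change σ (Language.Term.realize _ (ts 0)) < σ (Language.Term.realize _ (ts 1)) ↔
        σ' (Language.Term.realize _ (ts 0)) < σ' (Language.Term.realize _ (ts 1))
      rw [hi, hj]
      exact hV.lt_iff hs i j
  | imp a b iha ihb =>
    intro r hr v v' hs
    simp only [qr] at hr
    exact imp_congr (iha r (by omega) v v' hs) (ihb r (by omega) v v' hs)
  | all a ih =>
    intro r hr v v' hs
    simp only [qr] at hr
    obtain ⟨r, rfl⟩ : ∃ s, r = s + 1 := ⟨r - 1, by omega⟩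
    simp only [Language.BoundedFormula.Realize]
    constructor
    · intro h y
      obtain ⟨z, hz⟩ := hs.symm.forth (x'.symm y)
      have := (ih r (by omega) _ _ hz.symm).1 (by rw [Fin.comp_snoc]; exact h _)
      rw [Fin.comp_snoc] at this
      simpa using this
    · intro h y
      obtain ⟨z, hz⟩ := hs.forth (x.symm y)
      have := (ih r (by omega) _ _ hz).2 (by rw [Fin.comp_snoc]; exact h _)
      rw [Fin.comp_snoc] at this
      simpa using this

/-- main consequence -/
lemma sat_iff (φ : L2.Sentence) {m m' n n' : ℕ} {U : Type} {σ : Equiv.Perm (Fin n)}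
    {σ' : Equiv.Perm (Fin n')}
    (x : Fin m ⊕ U ≃ Fin n) (x' : Fin m' ⊕ U ≃ Fin n')
    (hP : Blk x x') (hV : Blk (σ ∘ x) (σ' ∘ x')) (hm : 2 ^ qr φ ≤ m) (hm' : 2 ^ qr φ ≤ m') :
    Sat2 σ φ ↔ Sat2 σ' φ := by
  have := ef x x' hP hV φ (qr φ) le_rfl Fin.elim0 Fin.elim0
    ⟨{(-1, -1), ((m : ℤ), (m' : ℤ))}, ?_, by simp, by simp, fun i => i.elim0⟩
  · unfold Sat2
    unfold Language.Sentence.Realize Language.Formula.Realize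
    convert this using 2
  · have h1 : (2 : ℤ) ^ qr φ ≤ m := by exact_mod_cast hm
    have h2 : (2 : ℤ) ^ qr φ ≤ m' := by exact_mod_cast hm'
    intro s hs t ht
    simp only [Finset.mem_insert, Finset.mem_singleton] at hs ht
    unfold near
    rcases hs with rfl | rfl <;> rcases ht with rfl | rfl <;> simp <;> omega


lemma sat1_conj {n n' : ℕ} {σ : Equiv.Perm (Fin n)} {σ' : Equiv.Perm (Fin n')} (e : Fin n ≃ Fin n')
    (h : ∀ x, e (σ x) = σ' (e x)) (φ : L1.Sentence) : Sat1 σ φ ↔ Sat1 σ' φ := by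
  letI := permStruc1 σ
  letI := permStruc1 σ'
  let g : Fin n ≃[L1] Fin n' :=
    { e with
      map_fun' := fun f => Empty.elim f
      map_rel' := by
        intro k R x
        cases R
        change σ' (e (x 0)) = e (x 1) ↔ σ (x 0) = x 1
        rw [← h, e.injective.eq_iff] }
  exact FirstOrder.Language.StrongHomClass.realize_sentence g φ

lemma mem_conj {E : Set Perms} (h1 : TOOBDef E) {n : ℕ} {σ τ : Equiv.Perm (Fin n)}
    (h : σ.cycleType = τ.cycleType) : (⟨n, σ⟩ : Perms) ∈ E ↔ (⟨n, τ⟩ : Perms) ∈ E := by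
  obtain ⟨φ, hφ⟩ := h1
  rw [← hφ, ← hφ]
  obtain ⟨c, hc⟩ := isConj_iff.1 (Equiv.Perm.isConj_iff_cycleType_eq.2 h)
  exact sat1_conj c (fun x => by rw [← hc]; simp) φ

def sumP {a r : ℕ} (σ : Equiv.Perm (Fin a)) (τ : Equiv.Perm (Fin r)) : Equiv.Perm (Fin (a + r)) :=
  finSumFinEquiv.permCongr (Equiv.sumCongr σ τ)

lemma sumP_castAdd {a r : ℕ} (σ : Equiv.Perm (Fin a)) (τ : Equiv.Perm (Fin r)) (i : Fin a) :
    sumP σ τ (Fin.castAdd r i) = Fin.castAdd r (σ i) := by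
  simp [sumP, Equiv.permCongr_apply]

lemma sumP_natAdd {a r : ℕ} (σ : Equiv.Perm (Fin a)) (τ : Equiv.Perm (Fin r)) (i : Fin r) :
    sumP σ τ (Fin.natAdd a i) = Fin.natAdd a (τ i) := by
  simp [sumP, Equiv.permCongr_apply]

def eL (a r : ℕ) : Fin a ≃ {x : Fin (a + r) // (x : ℕ) < a} where
  toFun i := ⟨Fin.castAdd r i, by simp⟩
  invFun x := ⟨x.1, x.2⟩
  left_inv i := by simp
  right_inv x := by ext; simp

def eR (a r : ℕ) : Fin r ≃ {x : Fin (a + r) // ¬ (x : ℕ) < a} where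
  toFun i := ⟨Fin.natAdd a i, by simp⟩
  invFun x := ⟨x.1 - a, by have := x.2; omega⟩
  left_inv i := by simp
  right_inv x := by ext; have := x.2; simp; omega

lemma sumP_cycleType {a r : ℕ} (σ : Equiv.Perm (Fin a)) (τ : Equiv.Perm (Fin r)) :
    (sumP σ τ).cycleType = σ.cycleType + τ.cycleType := by
  have key : sumP σ τ = σ.extendDomain (eL a r) * τ.extendDomain (eR a r) := by
    ext x
    refine Fin.addCases (fun i => ?_) (fun i => ?_) x
    · rw [sumP_castAdd, Equiv.Perm.mul_apply, Equiv.Perm.extendDomain_apply_not_subtype τ (eR a r) (b := Fin.castAdd r i) (by simp)]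
      have := Equiv.Perm.extendDomain_apply_image σ (eL a r) i
      simp only [eL, Equiv.coe_fn_mk] at this
      exact congrArg Fin.val this.symm
    · rw [sumP_natAdd, Equiv.Perm.mul_apply]
      have := Equiv.Perm.extendDomain_apply_image τ (eR a r) i
      simp only [eR, Equiv.coe_fn_mk] at this
      rw [eR, this, Equiv.Perm.extendDomain_apply_not_subtype _ _ (by simp)]
  have hd : (σ.extendDomain (eL a r)).Disjoint (τ.extendDomain (eR a r)) := by
    intro x
    by_cases hx : (x : ℕ) < a
    · right; exact Equiv.Perm.extendDomain_apply_not_subtype _ _ (by simpa using hx)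
    · left; exact Equiv.Perm.extendDomain_apply_not_subtype _ _ (by simpa using hx)
  rw [key, hd.cycleType_mul, Equiv.Perm.cycleType_extendDomain, Equiv.Perm.cycleType_extendDomain]

def Rot (a b : ℕ) : Equiv.Perm (Fin (a + b)) := finAddFlip.trans (finCongr (add_comm b a))

lemma Rot_castAdd (a b : ℕ) (i : Fin a) : (Rot a b (Fin.castAdd b i) : ℕ) = b + i := by
  simp [Rot, add_comm]

lemma Rot_natAdd (a b : ℕ) (i : Fin b) : (Rot a b (Fin.natAdd a i) : ℕ) = i := by
  simp [Rot]

lemma Rot_val (a b : ℕ) (x : Fin (a + b)) : (Rot a b x : ℕ) = (x + b) % (a + b) := by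
  refine Fin.addCases (fun i => ?_) (fun i => ?_) x
  · rw [Rot_castAdd, Fin.val_castAdd, Nat.mod_eq_of_lt (by omega)]; omega
  · rw [Rot_natAdd, Fin.val_natAdd]
    rw [show a + (i : ℕ) + b = i + (a + b) by omega, Nat.add_mod_right, Nat.mod_eq_of_lt (by omega)]

lemma Rot_pow_val (a b j : ℕ) (x : Fin (a + b)) :
    ((Rot a b ^ j) x : ℕ) = (x + j * b) % (a + b) := by
  induction j with
  | zero => simp [Nat.mod_eq_of_lt x.2]
  | succ j ih =>
    rw [pow_succ', Equiv.Perm.mul_apply, Rot_val, ih, Nat.mod_add_mod]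
    congr 1; ring

lemma cycleType_regular {N m c : ℕ} (hm : 2 ≤ m) (g : Equiv.Perm (Fin N)) (h1 : g ^ m = 1)
    (h2 : ∀ x, g x ≠ x → ∀ j, 0 < j → j < m → (g ^ j) x ≠ x) (h3 : g.support.card = c * m) :
    g.cycleType = Multiset.replicate c m := by
  have hall : ∀ n ∈ g.cycleType, n = m := by
    intro n hn
    have hd : n ∣ m := (Equiv.Perm.dvd_of_mem_cycleType hn).trans (orderOf_dvd_of_pow_eq_one h1)
    have hle := Nat.le_of_dvd (by omega) hd
    have h2n := Equiv.Perm.two_le_of_mem_cycleType hn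
    rw [Equiv.Perm.cycleType_def, Multiset.mem_map] at hn
    obtain ⟨f, hf, hfn⟩ := hn
    have hf' : f ∈ g.cycleFactorsFinset := hf
    have hcy := (Equiv.Perm.mem_cycleFactorsFinset_iff.1 hf').1
    obtain ⟨x, hx⟩ := hcy.nonempty_support
    have hxg := Equiv.Perm.mem_cycleFactorsFinset_support_le hf' hx
    have he := Equiv.Perm.cycle_is_cycleOf hx hf'
    simp only [Function.comp] at hfn
    by_contra hne
    refine h2 x (Equiv.Perm.mem_support.1 hxg) n (by omega) (by omega) ?_
    rw [← Equiv.Perm.cycleOf_pow_apply_self, ← he, ← hfn, ← hcy.orderOf, pow_orderOf_eq_one]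
    rfl
  have h4 := Multiset.eq_replicate_card.2 hall
  have h5 := g.sum_cycleType
  rw [h4, Multiset.sum_replicate, h3, smul_eq_mul] at h5
  rw [h4, Nat.eq_of_mul_eq_mul_right (by omega) h5]

lemma cycleType_Rot {a b m c : ℕ} (hm : 2 ≤ m) (hmc : a + b = c * m)
    (h1 : (a + b) ∣ m * b) (h2 : ∀ j, 0 < j → j < m → ¬ (a + b) ∣ j * b) :
    (Rot a b).cycleType = Multiset.replicate c m := by
  have hfree : ∀ x j, 0 < j → j < m → (Rot a b ^ j) x ≠ x := by
    intro x j h0 hj he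
    apply h2 j h0 hj
    have := congrArg Fin.val he
    rw [Rot_pow_val] at this
    have h3 : (x : ℕ) + j * b ≡ x + 0 [MOD (a + b)] := by
      unfold Nat.ModEq
      rw [this, add_zero, Nat.mod_eq_of_lt x.2]
    exact (Nat.modEq_zero_iff_dvd).1 (Nat.ModEq.add_left_cancel' _ h3)
  apply cycleType_regular hm
  · ext x
    rw [Rot_pow_val, Nat.add_mod, Nat.mod_eq_zero_of_dvd h1, add_zero, Nat.mod_mod,
      Nat.mod_eq_of_lt x.2]
    rfl
  · intro x _; exact hfree x
  · rw [← hmc]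
    have : (Rot a b).support = Finset.univ := by
      ext x
      simpa using hfree x 1 (by omega) (by omega)
    rw [this]; simp

lemma ct1 (N : ℕ) (hN : 1 ≤ N) : (Rot N 1).cycleType = {N + 1} := by
  rw [cycleType_Rot (m := N + 1) (c := 1) (by omega) (by omega) (by simp)]
  · rfl
  · intro j h0 hj h
    have := Nat.le_of_dvd (by omega) h
    omega

lemma ct2 (D : ℕ) (hD : 1 ≤ D) : (Rot D (D + 1)).cycleType = {2 * D + 1} := by
  rw [cycleType_Rot (m := 2 * D + 1) (c := 1) (by omega) (by omega)
    ⟨D + 1, by ring⟩]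
  · rfl
  · intro j h0 hj h
    have hc : Nat.Coprime (D + (D + 1)) (D + 1) := by simp
    have := Nat.le_of_dvd h0 (hc.dvd_of_dvd_mul_right h)
    omega

lemma ct3 (d k : ℕ) (hd : 1 ≤ d) (hk : 1 ≤ k) :
    (Rot d (k * d)).cycleType = Multiset.replicate d (k + 1) := by
  rw [cycleType_Rot (m := k + 1) (c := d) (by omega) (by ring) ⟨k, by ring⟩]
  intro j h0 hj h
  rw [show d + k * d = (k + 1) * d by ring, ← mul_assoc] at h
  have h := Nat.dvd_of_mul_dvd_mul_right hd h
  have hc : Nat.Coprime (k + 1) k := by simp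
  have := Nat.le_of_dvd h0 (hc.dvd_of_dvd_mul_right h)
  omega

lemma ct_rev {N d : ℕ} (h : N = 2 * d ∨ N = 2 * d + 1) :
    (Fin.revPerm : Equiv.Perm (Fin N)).cycleType = Multiset.replicate d 2 := by
  apply cycleType_regular le_rfl
  · ext x; simp [pow_two]
  · intro x hx j h0 h2
    obtain rfl : j = 1 := by omega
    simpa using hx
  · rcases h with rfl | rfl
    · have : (Fin.revPerm : Equiv.Perm (Fin (2 * d))).support = Finset.univ := by
        ext x
        simp [Fin.ext_iff, Fin.val_rev]
        omega
      rw [this]; simp; ring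
    · have : (Fin.revPerm : Equiv.Perm (Fin (2 * d + 1))).support =
          Finset.univ.erase ⟨d, by omega⟩ := by
        ext x
        simp [Fin.ext_iff, Fin.val_rev]
        omega
      rw [this, Finset.card_erase_of_mem (Finset.mem_univ _)]; simp; ring

def x1 (a b r : ℕ) : Fin a ⊕ (Fin b ⊕ Fin r) ≃ Fin (a + b + r) :=
  (Equiv.sumAssoc _ _ _).symm.trans
    ((Equiv.sumCongr finSumFinEquiv (Equiv.refl _)).trans finSumFinEquiv)

def x2 (a b r : ℕ) : Fin b ⊕ (Fin a ⊕ Fin r) ≃ Fin (a + b + r) :=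
  ((Equiv.sumAssoc _ _ _).symm.trans (Equiv.sumCongr (Equiv.sumComm _ _) (Equiv.refl _))).trans
    ((Equiv.sumCongr finSumFinEquiv (Equiv.refl _)).trans finSumFinEquiv)

section
variable (a b r : ℕ) (τ : Equiv.Perm (Fin r))

lemma x1a (i : Fin a) : x1 a b r (.inl i) = Fin.castAdd r (Fin.castAdd b i) := by simp [x1]
lemma x1b (i : Fin b) : x1 a b r (.inr (.inl i)) = Fin.castAdd r (Fin.natAdd a i) := by simp [x1]
lemma x1c (i : Fin r) : x1 a b r (.inr (.inr i)) = Fin.natAdd (a + b) i := by simp [x1]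
lemma x2a (i : Fin a) : x2 a b r (.inr (.inl i)) = Fin.castAdd r (Fin.castAdd b i) := by simp [x2]
lemma x2b (i : Fin b) : x2 a b r (.inl i) = Fin.castAdd r (Fin.natAdd a i) := by simp [x2]
lemma x2c (i : Fin r) : x2 a b r (.inr (.inr i)) = Fin.natAdd (a + b) i := by simp [x2]
end

lemma sat_rot1 (φ : L2.Sentence) {a a' b r : ℕ} (τ : Equiv.Perm (Fin r))
    (h : 2 ^ qr φ ≤ a) (h' : 2 ^ qr φ ≤ a') :
    Sat2 (sumP (Rot a b) τ) φ ↔ Sat2 (sumP (Rot a' b) τ) φ := by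
  refine sat_iff φ (x1 a b r) (x1 a' b r) ⟨?_, ?_, ?_, ?_⟩ ⟨?_, ?_, ?_, ?_⟩ h h'
  · rintro (u | u) (v | v) <;> simp only [x1b, x1c, Fin.lt_def, Fin.val_castAdd, Fin.val_natAdd] <;> omega
  · rintro i i' (v | v) <;> simp only [x1a, x1b, x1c, Fin.lt_def, Fin.val_castAdd, Fin.val_natAdd] <;> omega
  · rintro i i' (v | v) <;> simp only [x1a, x1b, x1c, Fin.lt_def, Fin.val_castAdd, Fin.val_natAdd] <;> omega
  · left
    constructor <;> intro i j hij <;>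
      simpa only [Function.comp, x1a, x1b, x1c, Fin.lt_def, Fin.val_castAdd, Fin.val_natAdd] using hij
  · rintro (u | u) (v | v) <;> simp only [Function.comp, x1b, x1c, sumP_castAdd, sumP_natAdd, Fin.lt_def, Fin.val_castAdd, Fin.val_natAdd, Rot_natAdd, Rot_castAdd] <;> omega
  · rintro i i' (v | v) <;> simp only [Function.comp, x1a, x1b, x1c, sumP_castAdd, sumP_natAdd, Fin.lt_def, Fin.val_castAdd, Fin.val_natAdd, Rot_natAdd, Rot_castAdd] <;> omega
  · rintro i i' (v | v) <;> simp only [Function.comp, x1a, x1b, x1c, sumP_castAdd, sumP_natAdd, Fin.lt_def, Fin.val_castAdd, Fin.val_natAdd, Rot_natAdd, Rot_castAdd] <;> omega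
  · left
    constructor <;> intro i j hij <;> rw [Fin.lt_def] at hij <;>
      simp only [Function.comp, x1a, sumP_castAdd, Fin.lt_def, Fin.val_castAdd, Rot_castAdd] <;> omega

lemma sat_rot2 (φ : L2.Sentence) {a b b' r : ℕ} (τ : Equiv.Perm (Fin r))
    (h : 2 ^ qr φ ≤ b) (h' : 2 ^ qr φ ≤ b') :
    Sat2 (sumP (Rot a b) τ) φ ↔ Sat2 (sumP (Rot a b') τ) φ := by
  refine sat_iff φ (x2 a b r) (x2 a b' r) ⟨?_, ?_, ?_, ?_⟩ ⟨?_, ?_, ?_, ?_⟩ h h'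
  · rintro (u | u) (v | v) <;> simp only [x2a, x2c, Fin.lt_def, Fin.val_castAdd, Fin.val_natAdd] <;> omega
  · rintro i i' (v | v) <;> simp only [x2a, x2b, x2c, Fin.lt_def, Fin.val_castAdd, Fin.val_natAdd] <;> omega
  · rintro i i' (v | v) <;> simp only [x2a, x2b, x2c, Fin.lt_def, Fin.val_castAdd, Fin.val_natAdd] <;> omega
  · left
    constructor <;> intro i j hij <;> rw [Fin.lt_def] at hij <;>
      simp only [Function.comp, x2b, Fin.lt_def, Fin.val_castAdd, Fin.val_natAdd] <;> omega
  · rintro (u | u) (v | v) <;> simp only [Function.comp, x2a, x2c, sumP_castAdd, sumP_natAdd, Fin.lt_def, Fin.val_castAdd, Fin.val_natAdd, Rot_natAdd, Rot_castAdd] <;> omega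
  · rintro i i' (v | v) <;> simp only [Function.comp, x2a, x2b, x2c, sumP_castAdd, sumP_natAdd, Fin.lt_def, Fin.val_castAdd, Fin.val_natAdd, Rot_natAdd, Rot_castAdd] <;> omega
  · rintro i i' (v | v) <;> simp only [Function.comp, x2a, x2b, x2c, sumP_castAdd, sumP_natAdd, Fin.lt_def, Fin.val_castAdd, Fin.val_natAdd, Rot_natAdd, Rot_castAdd] <;> omega
  · left
    constructor <;> intro i j hij <;> rw [Fin.lt_def] at hij <;>
      simp only [Function.comp, x2b, sumP_castAdd, Fin.lt_def, Fin.val_castAdd, Rot_natAdd] <;> omega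

lemma sat_rev (φ : L2.Sentence) {a a' r : ℕ} (τ : Equiv.Perm (Fin r))
    (h : 2 ^ qr φ ≤ a) (h' : 2 ^ qr φ ≤ a') :
    Sat2 (sumP (Fin.revPerm : Equiv.Perm (Fin a)) τ) φ ↔
      Sat2 (sumP (Fin.revPerm : Equiv.Perm (Fin a')) τ) φ := by
  refine sat_iff φ (finSumFinEquiv (m := a) (n := r)) (finSumFinEquiv (m := a') (n := r))
    ⟨?_, ?_, ?_, ?_⟩ ⟨?_, ?_, ?_, ?_⟩ h h'
  · intro u v; simp only [finSumFinEquiv_apply_right, Fin.lt_def, Fin.val_natAdd]; omega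
  · intro i i' v; simp only [finSumFinEquiv_apply_left, finSumFinEquiv_apply_right, Fin.lt_def, Fin.val_castAdd, Fin.val_natAdd]; omega
  · intro i i' v; simp only [finSumFinEquiv_apply_left, finSumFinEquiv_apply_right, Fin.lt_def, Fin.val_castAdd, Fin.val_natAdd]; omega
  · left
    constructor <;> intro i j hij <;> simpa only [Function.comp, finSumFinEquiv_apply_left, Fin.lt_def, Fin.val_castAdd] using hij
  · intro u v; simp only [Function.comp, finSumFinEquiv_apply_right, Fin.lt_def, Fin.val_natAdd, sumP_natAdd]; omega
  · intro i i' v; simp only [Function.comp, finSumFinEquiv_apply_left, finSumFinEquiv_apply_right, Fin.lt_def, Fin.val_castAdd, Fin.val_natAdd, sumP_castAdd, sumP_natAdd]; omega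
  · intro i i' v; simp only [Function.comp, finSumFinEquiv_apply_left, finSumFinEquiv_apply_right, Fin.lt_def, Fin.val_castAdd, Fin.val_natAdd, sumP_castAdd, sumP_natAdd]; omega
  · right
    constructor <;> intro i j hij <;> rw [Fin.lt_def] at hij <;>
      simp only [Function.comp, finSumFinEquiv_apply_left, Fin.lt_def, Fin.val_castAdd, sumP_castAdd, Fin.revPerm_apply, Fin.val_rev] <;> omega

def PP (E : Set Perms) (s : Multiset ℕ) (f : ℕ) : Prop :=
  ∃ (n : ℕ) (σ : Equiv.Perm (Fin n)), n = s.sum + f ∧ σ.cycleType = s ∧ (⟨n, σ⟩ : Perms) ∈ E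

lemma PP_iff {E : Set Perms} (h1 : TOOBDef E) {n : ℕ} {σ : Equiv.Perm (Fin n)} {s : Multiset ℕ}
    {f : ℕ} (hn : n = s.sum + f) (hs : σ.cycleType = s) :
    (⟨n, σ⟩ : Perms) ∈ E ↔ PP E s f := by
  constructor
  · intro h; exact ⟨n, σ, hn, hs, h⟩
  · rintro ⟨n', σ', hn', hs', h⟩
    obtain rfl : n' = n := by omega
    exact (mem_conj h1 (hs.trans hs'.symm)).2 h

section
variable {E : Set Perms} (h1 : TOOBDef E) {φ : L2.Sentence}
  (hφ : ∀ (n : ℕ) (σ : Equiv.Perm (Fin n)), Sat2 σ φ ↔ (⟨n, σ⟩ : Perms) ∈ E)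

lemma ex_tau {s : Multiset ℕ} (hs : ∀ a ∈ s, 2 ≤ a) (f : ℕ) :
    ∃ τ : Equiv.Perm (Fin (s.sum + f)), τ.cycleType = s :=
  Equiv.Perm.exists_with_cycleType_iff _ |>.2 ⟨by simp, hs⟩

include h1 hφ

lemma PP_of_sat {A B : ℕ} {α : Equiv.Perm (Fin A)} {β : Equiv.Perm (Fin B)} {s u v : Multiset ℕ}
    {f g h : ℕ} (hs : ∀ a ∈ s, 2 ≤ a) (hα : α.cycleType = u) (hβ : β.cycleType = v)
    (hA : A = u.sum + g) (hB : B = v.sum + h)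
    (H : ∀ (r : ℕ) (τ : Equiv.Perm (Fin r)), Sat2 (sumP α τ) φ ↔ Sat2 (sumP β τ) φ) :
    PP E (u + s) (f + g) ↔ PP E (v + s) (f + h) := by
  obtain ⟨τ, hτ⟩ := ex_tau hs f
  rw [← PP_iff h1 (σ := sumP α τ), ← PP_iff h1 (σ := sumP β τ), ← hφ, ← hφ]
  · exact H _ τ
  · rw [Multiset.sum_add]; omega
  · rw [sumP_cycleType, hβ, hτ]
  · rw [Multiset.sum_add]; omega
  · rw [sumP_cycleType, hα, hτ]

lemma PP_big {N N' : ℕ} (hN : 2 ^ qr φ + 1 ≤ N) (hN' : 2 ^ qr φ + 1 ≤ N') {s : Multiset ℕ}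
    (hs : ∀ a ∈ s, 2 ≤ a) (f : ℕ) : PP E (N ::ₘ s) f ↔ PP E (N' ::ₘ s) f := by
  have hD : 1 ≤ 2 ^ qr φ := Nat.one_le_two_pow
  obtain ⟨N, rfl⟩ : ∃ k, N = k + 1 := ⟨N - 1, by omega⟩
  obtain ⟨N', rfl⟩ : ∃ k, N' = k + 1 := ⟨N' - 1, by omega⟩
  have := PP_of_sat h1 hφ (f := f) (g := 0) (h := 0) hs (ct1 N (by omega)) (ct1 N' (by omega))
    (by simp) (by simp) (fun r τ => sat_rot1 φ τ (by omega) (by omega))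
  simpa using this

lemma PP_split {d m : ℕ} (hd : 2 ^ qr φ ≤ d) (hm : 2 ≤ m) {s : Multiset ℕ}
    (hs : ∀ a ∈ s, 2 ≤ a) (f : ℕ) :
    PP E ((2 * 2 ^ qr φ + 1) ::ₘ s) f ↔ PP E (Multiset.replicate d m + s) f := by
  have hD : 1 ≤ 2 ^ qr φ := Nat.one_le_two_pow
  obtain ⟨k, rfl⟩ : ∃ k, m = k + 1 := ⟨m - 1, by omega⟩
  have hkd : d ≤ k * d := Nat.le_mul_of_pos_left _ (by omega)
  have := PP_of_sat h1 hφ (f := f) (g := 0) (h := 0) hs (ct2 _ hD) (ct3 d k (by omega) (by omega))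
    (by simp; ring) (by simp; ring) (fun r τ => (sat_rot1 φ τ le_rfl hd).trans
      (sat_rot2 φ τ (by omega) (by omega)))
  simpa using this

lemma PP_fix {s : Multiset ℕ} (hs : ∀ a ∈ s, 2 ≤ a) (f : ℕ) :
    PP E ((2 * 2 ^ qr φ + 1) ::ₘ s) f ↔ PP E ((2 * 2 ^ qr φ + 1) ::ₘ s) (f + 1) := by
  rw [PP_split h1 hφ le_rfl le_rfl hs, PP_split h1 hφ le_rfl le_rfl hs]
  have := PP_of_sat h1 hφ (f := f) (g := 0) (h := 1) hs
    (ct_rev (d := 2 ^ qr φ) (Or.inl rfl)) (ct_rev (d := 2 ^ qr φ) (Or.inr rfl))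
    (by simp; ring) (by simp; ring) (fun r τ => sat_rev φ τ (by omega) (by omega))
  simpa using this

lemma PP_absorb {s : Multiset ℕ} (hs : ∀ a ∈ s, 2 ≤ a) (f : ℕ) :
    PP E ((2 * 2 ^ qr φ + 1) ::ₘ s) f ↔ PP E {2 * 2 ^ qr φ + 1} 0 := by
  induction s using Multiset.induction with
  | empty =>
    induction f with
    | zero => rfl
    | succ f ih => rw [← ih, ← PP_fix h1 hφ (by simp)]
  | cons m s ih =>
    have hs' : ∀ a ∈ s, 2 ≤ a := fun a ha => hs a (Multiset.mem_cons_of_mem ha)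
    have hm : 2 ≤ m := hs m (Multiset.mem_cons_self _ _)
    rw [← ih hs', PP_split h1 hφ (d := 2 ^ qr φ) le_rfl hm hs,
      PP_split h1 hφ (d := 2 ^ qr φ + 1) (by omega) hm hs', Multiset.replicate_succ]
    simp

lemma PP_main {s : Multiset ℕ} (hs : ∀ a ∈ s, 2 ≤ a) (f : ℕ)
    (hM : (2 ^ qr φ + 1) * (2 ^ qr φ * 2 ^ qr φ) + 1 ≤ s.sum) :
    PP E s f ↔ PP E {2 * 2 ^ qr φ + 1} 0 := by
  by_cases hb : ∃ N ∈ s, 2 ^ qr φ + 1 ≤ N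
  · obtain ⟨N, hN, hle⟩ := hb
    obtain ⟨t, rfl⟩ := Multiset.exists_cons_of_mem hN
    have hs' : ∀ a ∈ t, 2 ≤ a := fun a ha => hs a (Multiset.mem_cons_of_mem ha)
    rw [PP_big h1 hφ hle (N' := 2 * 2 ^ qr φ + 1) (by omega) hs', PP_absorb h1 hφ hs']
  · push Not at hb
    have : ∃ m ∈ s, 2 ^ qr φ ≤ s.count m := by
      by_contra hc
      push Not at hc
      have hsum : s.sum ≤ (2 ^ qr φ + 1) * (2 ^ qr φ * 2 ^ qr φ) := by
        rw [Finset.sum_multiset_count]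
        calc _ ≤ ∑ m ∈ s.toFinset, 2 ^ qr φ * 2 ^ qr φ := by
              apply Finset.sum_le_sum
              intro m hm
              rw [Multiset.mem_toFinset] at hm
              rw [smul_eq_mul]
              exact Nat.mul_le_mul (hc m hm).le (by have := hb m hm; omega)
          _ ≤ ∑ m ∈ Finset.range (2 ^ qr φ + 1), 2 ^ qr φ * 2 ^ qr φ := by
              apply Finset.sum_le_sum_of_subset
              intro m hm
              rw [Multiset.mem_toFinset] at hm
              exact Finset.mem_range.2 (hb m hm)
          _ = _ := by simp
      omega
    obtain ⟨m, hm, hc⟩ := this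
    obtain ⟨t, ht⟩ := Multiset.le_iff_exists_add.1 (Multiset.le_count_iff_replicate_le.1 hc)
    have hs' : ∀ a ∈ t, 2 ≤ a := fun a ha => hs a (by rw [ht]; simp [ha])
    rw [ht, ← PP_split h1 hφ le_rfl (hs m hm) hs', PP_absorb h1 hφ hs']

lemma mem_main (p : Perms)
    (hM : (2 ^ qr φ + 1) * (2 ^ qr φ * 2 ^ qr φ) + 1 ≤ p.2.support.card) :
    p ∈ E ↔ PP E {2 * 2 ^ qr φ + 1} 0 := by
  obtain ⟨n, σ⟩ := p
  simp only at hM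
  rw [← Equiv.Perm.sum_cycleType] at hM
  have hle : σ.cycleType.sum ≤ n := by simpa using σ.sum_cycleType_le
  rw [← PP_main h1 hφ (s := σ.cycleType) (f := n - σ.cycleType.sum)
    (fun a ha => Equiv.Perm.two_le_of_mem_cycleType ha) hM]
  exact PP_iff h1 (by omega) rfl

end

end TT

theorem TOTO_and_TOOB_definable_trivial (E : Set Perms)
    (h2 : TOTODef E) (h1 : TOOBDef E) :
    (∃ M : ℕ, ∀ p : Perms, M ≤ p.2.support.card → p ∈ E) ∨
      (∃ M : ℕ, ∀ p : Perms, p ∈ E → p.2.support.card ≤ M) := by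
  obtain ⟨φ, hφ⟩ := h2
  by_cases hc : TT.PP E {2 * 2 ^ TT.qr φ + 1} 0
  · left
    exact ⟨_, fun p hp => (TT.mem_main h1 hφ p hp).2 hc⟩
  · right
    refine ⟨(2 ^ TT.qr φ + 1) * (2 ^ TT.qr φ * 2 ^ TT.qr φ) + 1, fun p hp => ?_⟩
    by_contra hlt
    exact hc ((TT.mem_main h1 hφ p (by omega)).1 hp)
end
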